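/- arXiv:2507.02133 — 6 statements merged into one kernel-verified Lean document; each statement's English description precedes it below -/
import Mathlib

section
/- Let c₁, c₂ ∈ ℂ and define the quartic map F : ℂ → ℂ by F(z) = (z² + c₁)² + c₂. Then the alternated filled Julia set K_{c₁c₂} equals the filled Julia set of F; that is, for every z₀ ∈ ℂ, the alternated orbit of z₀ is bounded if and only if the forward orbit (Fⁿ(z₀))_{n≥0} is bounded. -/
/-- The alternated orbit of `z₀` under the quadratic maps `z ↦ z² + c₁` (applied at even
indices) and `z ↦ z² + c₂` (applied at odd indices): `z 0 = z₀`,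
`z (2i+1) = z (2i)² + c₁`, `z (2i+2) = z (2i+1)² + c₂`. -/
def altOrbit (c₁ c₂ z₀ : ℂ) : ℕ → ℂ
  | 0 => z₀
  | n + 1 => (altOrbit c₁ c₂ z₀ n) ^ 2 + (if Even n then c₁ else c₂)

theorem altOrbit_two_mul_add_one (c₁ c₂ z₀ : ℂ) (n : ℕ) :
    altOrbit c₁ c₂ z₀ (2 * n + 1) = altOrbit c₁ c₂ z₀ (2 * n) ^ 2 + c₁ := by
  simp [altOrbit]

theorem altOrbit_two_mul_add_two (c₁ c₂ z₀ : ℂ) (n : ℕ) :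
    altOrbit c₁ c₂ z₀ (2 * n + 2) = altOrbit c₁ c₂ z₀ (2 * n + 1) ^ 2 + c₂ := by
  rw [altOrbit, if_neg (by simp)]

theorem altOrbit_two_mul (c₁ c₂ z₀ : ℂ) (n : ℕ) :
    altOrbit c₁ c₂ z₀ (2 * n) = (fun z : ℂ => (z ^ 2 + c₁) ^ 2 + c₂)^[n] z₀ := by
  induction n with
  | zero => rfl
  | succ n ih =>
    rw [Function.iterate_succ_apply', ← ih, mul_add_one, altOrbit_two_mul_add_two,
      altOrbit_two_mul_add_one]

/-- The alternated filled Julia set `K_{c₁c₂}` equals the filled Julia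
set of the quartic map `F(z) = (z² + c₁)² + c₂`: for every `z₀ ∈ ℂ`, the alternated
orbit of `z₀` is bounded iff the forward orbit of `z₀` under `F` is bounded. -/
theorem alternated_filledJulia_eq_quartic_filledJulia (c₁ c₂ : ℂ) (z₀ : ℂ) :
    (∃ M : ℝ, 0 ≤ M ∧ ∀ n : ℕ, ‖altOrbit c₁ c₂ z₀ n‖ ≤ M) ↔
      (∃ M : ℝ, 0 ≤ M ∧ ∀ n : ℕ, ‖(fun z : ℂ => (z ^ 2 + c₁) ^ 2 + c₂)^[n] z₀‖ ≤ M) := by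
  simp only [← altOrbit_two_mul]
  constructor
  · rintro ⟨M, hM, h⟩
    exact ⟨M, hM, fun n => h (2 * n)⟩
  · rintro ⟨M, hM, h⟩
    refine ⟨max M (M ^ 2 + ‖c₁‖), le_max_of_le_left hM, fun n => ?_⟩
    obtain ⟨k, rfl | rfl⟩ := n.even_or_odd'
    · exact le_max_of_le_left (h k)
    · refine le_max_of_le_right ?_
      rw [altOrbit_two_mul_add_one]
      refine (norm_add_le _ _).trans ?_
      rw [norm_pow]
      gcongr
      exact h k
end

section
/- Let F be a polynomial over ℂ of degree at least 2. The Julia set J(F), i.e. the topological frontier of the filled Julia set K(F), is a connected subset of ℂ if and only if every critical point of F (every root of the derivative F′) has bounded forward orbit under iteration of F. -/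
open Polynomial Filter Topology unitInterval

theorem isPreconnected_setOf_le_norm {M : ℝ} (hM : 0 < M) :
    IsPreconnected {z : ℂ | M ≤ ‖z‖} := by
  have h : {z : ℂ | M ≤ ‖z‖} = Complex.exp '' {s | Real.log M ≤ s.re} := by
    ext z
    constructor
    · intro hz
      have hz : M ≤ ‖z‖ := hz
      have hz0 : z ≠ 0 := norm_pos_iff.mp (hM.trans_le hz)
      exact ⟨Complex.log z, by simpa [Complex.log_re] using Real.log_le_log hM hz,
        Complex.exp_log hz0⟩
    · rintro ⟨s, hs, rfl⟩
      simpa [Complex.norm_exp] using (Real.log_le_iff_le_exp hM).mp hs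
  rw [h]
  exact (convex_halfSpace_re_ge _).isPreconnected.image _ Complex.continuous_exp.continuousOn

theorem isPreconnected_setOf_lt_norm {M : ℝ} (hM : 0 < M) :
    IsPreconnected {z : ℂ | M < ‖z‖} := by
  have h : {z : ℂ | M < ‖z‖} = Complex.exp '' {s | Real.log M < s.re} := by
    ext z
    constructor
    · intro hz
      have hz : M < ‖z‖ := hz
      have hz0 : z ≠ 0 := norm_pos_iff.mp (hM.trans hz)
      exact ⟨Complex.log z, by simpa [Complex.log_re] using Real.log_lt_log hM hz,
        Complex.exp_log hz0⟩
    · rintro ⟨s, hs, rfl⟩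
      simpa [Complex.norm_exp] using (Real.log_lt_iff_lt_exp hM).mp hs
  rw [h]
  exact (convex_halfSpace_re_gt _).isPreconnected.image _ Complex.continuous_exp.continuousOn

theorem Polynomial.exists_forall_le_norm_eval {P : ℂ[X]} (hP : 0 < P.degree) (R : ℝ) :
    ∃ M : ℝ, 0 < M ∧ ∀ z : ℂ, M ≤ ‖z‖ → R ≤ ‖P.eval z‖ := by
  have h := (P.tendsto_norm_atTop hP (tendsto_norm_cocompact_atTop (E := ℂ))).eventually
    (eventually_ge_atTop R)
  rw [← Metric.cobounded_eq_cocompact, ← comap_norm_atTop, eventually_comap] at h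
  obtain ⟨M, hM⟩ := eventually_atTop.mp h
  exact ⟨max M 1, by positivity, fun z hz ↦ hM _ ((le_max_left _ _).trans hz) z rfl⟩

/-- If all critical values of a polynomial lie inside the disc of radius `R`, then the level set
`‖P z‖ = R` is connected. -/
theorem Polynomial.isPreconnected_setOf_norm_eval_eq {P : ℂ[X]} (hP : 0 < P.degree) {R : ℝ}
    (hR : 0 < R) (hcrit : ∀ c : ℂ, P.derivative.eval c = 0 → ‖P.eval c‖ < R) :
    IsPreconnected {z : ℂ | ‖P.eval z‖ = R} := by
  set S : Set ℂ := {w | R ≤ ‖w‖}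
  have cov : IsCoveringMap (S.restrictPreimage P.eval) := by
    refine (P.isCoveringMapOn_eval.mono ?_).isCoveringMap_restrictPreimage
    rintro w hw ⟨c, hc, rfl⟩
    exact absurd (hcrit c hc) (not_lt.mpr hw)
  obtain ⟨M, hM0, hM⟩ := P.exists_forall_le_norm_eval hP R
  obtain ⟨T, hT⟩ := (isCompact_closedBall (0 : ℂ) M).exists_bound_of_continuousOn
    P.continuous.continuousOn
  have hT0 : 0 ≤ T := (norm_nonneg _).trans (hT 0 (by simp [hM0.le]))
  set A : Set ℂ := {z | M ≤ ‖z‖}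
  have : PreconnectedSpace A :=
    Subtype.preconnectedSpace (isPreconnected_setOf_le_norm hM0)
  have hne : ∀ a : A, ‖P.eval a.1‖ ≠ 0 := fun a ↦ (hR.trans_le (hM _ a.2)).ne'
  have key : ∀ (t : I) (w : ℂ), R ≤ ‖w‖ →
      R ≤ ‖(((1 - t : ℝ) + t * (R / ‖w‖) : ℝ) : ℂ) * w‖ := by
    intro t w hw
    have h0 : 0 < ‖w‖ := hR.trans_le hw
    have ht0 := t.2.1
    have ht1 : 0 ≤ 1 - (t : ℝ) := sub_nonneg.mpr t.2.2
    have h1 : 0 ≤ (1 - t : ℝ) + t * (R / ‖w‖) := by positivity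
    rw [norm_mul, Complex.norm_real, Real.norm_of_nonneg h1]
    have : ((1 - t : ℝ) + t * (R / ‖w‖)) * ‖w‖ = (1 - t) * ‖w‖ + t * R := by field_simp
    rw [this]
    nlinarith
  let H : C(I × A, S) :=
    ⟨fun x ↦ ⟨(((1 - x.1 : ℝ) + x.1 * (R / ‖P.eval x.2.1‖) : ℝ) : ℂ) * P.eval x.2.1,
      key x.1 _ (hM _ x.2.2)⟩, by
      refine Continuous.subtype_mk ?_ _
      have hc : Continuous fun x : I × A ↦ P.eval x.2.1 := P.continuous.comp (by fun_prop)
      refine Continuous.mul (Complex.continuous_ofReal.comp ?_) hc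
      refine Continuous.add (by fun_prop) (Continuous.mul (by fun_prop) ?_)
      exact continuous_const.div hc.norm fun x ↦ hne x.2⟩
  let f : C(A, P.eval ⁻¹' S) := ⟨fun a ↦ ⟨a.1, hM _ a.2⟩, by fun_prop⟩
  have H0 : ∀ a, H (0, a) = S.restrictPreimage P.eval (f a) := by
    intro a
    apply Subtype.ext
    simp [H, f]
  let L := cov.liftHomotopy H f H0
  have hL : ∀ t a, P.eval (L (t, a)).1 = (H (t, a)).1 := fun t a ↦
    congrArg Subtype.val (congrFun (cov.liftHomotopy_lifts H f H0) (t, a))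
  have hrange : {z : ℂ | ‖P.eval z‖ = R} = Set.range fun a ↦ (L (1, a)).1 := by
    ext z
    constructor
    · intro hz
      have hz : ‖P.eval z‖ = R := hz
      have hk : 0 ≤ T / R := by positivity
      have key' : ∀ t : I, ‖((1 + t * (T / R) : ℝ) : ℂ) * P.eval z‖ = (1 + t * (T / R)) * R := by
        intro t
        have := t.2.1
        rw [norm_mul, Complex.norm_real, Real.norm_of_nonneg (by positivity), hz]
      let γ : C(I, S) := ⟨fun t ↦ ⟨((1 + t * (T / R) : ℝ) : ℂ) * P.eval z, by
          have := t.2.1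
          have : 0 ≤ t * (T / R) := by positivity
          simp only [S, Set.mem_ofPred_eq, key' t]
          nlinarith⟩, by
        refine Continuous.subtype_mk ?_ _
        exact (Complex.continuous_ofReal.comp (by fun_prop)).mul continuous_const⟩
      let e : P.eval ⁻¹' S := ⟨z, hz.ge⟩
      have γ0 : γ 0 = S.restrictPreimage P.eval e := by
        apply Subtype.ext
        simp [γ, e]
      obtain ⟨Γ, hΓ, hΓ0⟩ := cov.exists_path_lifts γ e γ0
      have hΓ' : ∀ t, P.eval (Γ t).1 = ((1 + t * (T / R) : ℝ) : ℂ) * P.eval z := fun t ↦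
        congrArg Subtype.val (congrFun hΓ t)
      have hy : M ≤ ‖(Γ 1).1‖ := by
        by_contra! hlt
        have h1 := hT (Γ 1).1 (by simpa using hlt.le)
        rw [hΓ' 1, key' 1] at h1
        have : (1 + ((1 : I) : ℝ) * (T / R)) * R = R + T := by
          simp
          field_simp
        linarith
      let a : A := ⟨(Γ 1).1, hy⟩
      refine ⟨a, ?_⟩
      have heq : (fun t ↦ Γ (σ t)) = fun t ↦ L (t, a) := by
        refine cov.eq_of_comp_eq (by fun_prop) (by fun_prop) ?_ 0 ?_
        · funext t
          apply Subtype.ext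
          change P.eval (Γ (σ t)).1 = P.eval (L (t, a)).1
          rw [hL, hΓ']
          simp only [H, a, ContinuousMap.coe_mk, hΓ', key', ← mul_assoc]
          congr 1
          norm_cast
          have : 1 + T / R ≠ 0 := by positivity
          simp only [coe_symm_eq]
          field_simp
          ring
        · simp only [symm_zero, L, cov.liftHomotopy_zero]
          exact Subtype.ext rfl
      have := congrFun heq 1
      simp only [symm_one, hΓ0] at this
      exact (congrArg Subtype.val this).symm
    · rintro ⟨a, rfl⟩
      simp only [Set.mem_ofPred_eq, hL, H, ContinuousMap.coe_mk]
      rw [norm_mul, Complex.norm_real, Set.Icc.coe_one, sub_self, zero_add, one_mul,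
        Real.norm_of_nonneg (by positivity), div_mul_cancel₀ _ (hne a)]
  rw [hrange]
  exact isPreconnected_range (by fun_prop)


/-- The points with bounded forward orbit under `f`. -/
def boundedOrbits (f : ℂ → ℂ) : Set ℂ :=
  {z | ∃ M : ℝ, 0 ≤ M ∧ ∀ n : ℕ, ‖f^[n] z‖ ≤ M}

/-- Outside the disc of radius `R`, the map `f` at least doubles the norm. -/
def IsEscapeRadius (f : ℂ → ℂ) (R : ℝ) : Prop :=
  0 < R ∧ ∀ z, R ≤ ‖z‖ → 2 * ‖z‖ ≤ ‖f z‖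

namespace IsEscapeRadius

variable {f : ℂ → ℂ} {R : ℝ}

theorem pow_mul_le_norm_iterate (h : IsEscapeRadius f R) {z : ℂ} (hz : R ≤ ‖z‖) (m : ℕ) :
    2 ^ m * R ≤ ‖f^[m] z‖ := by
  induction m with
  | zero => simpa using hz
  | succ m ih =>
    have h1 : (1 : ℝ) ≤ 2 ^ m := one_le_pow₀ one_le_two
    have h2 := h.2 (f^[m] z) (by nlinarith [h.1])
    rw [Function.iterate_succ_apply', pow_succ]
    linarith

theorem le_norm_iterate (h : IsEscapeRadius f R) {z : ℂ} {n m : ℕ} (hnm : n ≤ m)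
    (hz : R ≤ ‖f^[n] z‖) : R ≤ ‖f^[m] z‖ := by
  obtain ⟨k, rfl⟩ := Nat.exists_eq_add_of_le' hnm
  rw [Function.iterate_add_apply]
  have := h.pow_mul_le_norm_iterate hz k
  have h1 : (1 : ℝ) ≤ 2 ^ k := one_le_pow₀ one_le_two
  nlinarith [h.1]

theorem mem_boundedOrbits_iff (h : IsEscapeRadius f R) {z : ℂ} :
    z ∈ boundedOrbits f ↔ ∀ n, ‖f^[n] z‖ < R := by
  refine ⟨fun ⟨M, _, hM⟩ n ↦ ?_, fun hz ↦ ⟨R, h.1.le, fun n ↦ (hz n).le⟩⟩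
  by_contra! hn
  obtain ⟨m, hm⟩ := pow_unbounded_of_one_lt (M / R) one_lt_two
  have h1 := h.pow_mul_le_norm_iterate hn m
  rw [← Function.iterate_add_apply] at h1
  have h2 := hM (m + n)
  rw [div_lt_iff₀ h.1] at hm
  linarith

theorem iterate_mem_boundedOrbits_iff (h : IsEscapeRadius f R) {z : ℂ} (k : ℕ) :
    f^[k] z ∈ boundedOrbits f ↔ z ∈ boundedOrbits f := by
  simp only [h.mem_boundedOrbits_iff, ← Function.iterate_add_apply]
  refine ⟨fun hz n ↦ ?_, fun hz n ↦ hz _⟩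
  by_contra! hn
  exact absurd (h.le_norm_iterate (Nat.le_add_right n k) hn) (not_le.mpr (hz n))

theorem exists_le_norm_iterate (h : IsEscapeRadius f R) {z : ℂ} (hz : z ∉ boundedOrbits f) :
    ∃ n, R ≤ ‖f^[n] z‖ := by
  simpa [h.mem_boundedOrbits_iff] using hz

theorem mem_boundedOrbits_of_le (h : IsEscapeRadius f R) {z : ℂ} (hz : ∀ n, ‖f^[n] z‖ ≤ R) :
    z ∈ boundedOrbits f := ⟨R, h.1.le, hz⟩

theorem isCompact_boundedOrbits (h : IsEscapeRadius f R) (hf : Continuous f) :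
    IsCompact (boundedOrbits f) := by
  have heq : boundedOrbits f = ⋂ n, {z | ‖f^[n] z‖ ≤ R} := by
    ext z
    simp only [Set.mem_iInter]
    exact ⟨fun hz n ↦ (h.mem_boundedOrbits_iff.mp hz n).le, h.mem_boundedOrbits_of_le⟩
  refine (isCompact_closedBall (0 : ℂ) R).of_isClosed_subset ?_ fun z hz ↦ ?_
  · rw [heq]
    exact isClosed_iInter fun n ↦ isClosed_le (hf.iterate n).norm continuous_const
  · simpa using (h.mem_boundedOrbits_iff.mp hz 0).le

theorem frontier_subset (h : IsEscapeRadius f R) (hf : Continuous f) :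
    frontier (boundedOrbits f) ⊆ boundedOrbits f :=
  (h.isCompact_boundedOrbits hf).isClosed.frontier_subset

theorem isCompact_frontier (h : IsEscapeRadius f R) (hf : Continuous f) :
    IsCompact (frontier (boundedOrbits f)) :=
  (h.isCompact_boundedOrbits hf).of_isClosed_subset isClosed_frontier (h.frontier_subset hf)

/-- The level sets `‖f^[n] z‖ = R` accumulate only on the frontier of the set of bounded orbits. -/
theorem exists_levelSet_subset (h : IsEscapeRadius f R) (hf : Continuous f) {U : Set ℂ}
    (hU : IsOpen U) (hJU : frontier (boundedOrbits f) ⊆ U) :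
    ∃ N, ∀ n ≥ N, {z | ‖f^[n] z‖ = R} ⊆ U := by
  set Z : ℕ → Set ℂ := fun n ↦ closure (boundedOrbits f)ᶜ ∩ {z | ‖f^[n] z‖ ≤ R} ∩ Uᶜ
  have hclosed : ∀ n, IsClosed (Z n) := fun n ↦
    (isClosed_closure.inter (isClosed_le (hf.iterate n).norm continuous_const)).inter
      hU.isClosed_compl
  have hmono : ∀ n, {z | ‖f^[n + 1] z‖ ≤ R} ⊆ {z | ‖f^[n] z‖ ≤ R} := by
    intro n z hz
    by_contra hn
    have hn : R < ‖f^[n] z‖ := not_le.mp hn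
    have hz : ‖f^[n + 1] z‖ ≤ R := hz
    rw [Function.iterate_succ_apply'] at hz
    linarith [h.2 _ hn.le, h.1]
  have hanti : Antitone fun n ↦ {z | ‖f^[n] z‖ ≤ R} := antitone_nat_of_succ_le hmono
  obtain ⟨N, hN⟩ : ∃ N, ¬ (Z N).Nonempty := by
    by_contra! hne
    obtain ⟨z, hz⟩ := IsCompact.nonempty_iInter_of_sequence_nonempty_isCompact_isClosed Z
      (fun n ↦ Set.inter_subset_inter_left _ (Set.inter_subset_inter_right _ (hmono n))) hne
      ((isCompact_closedBall (0 : ℂ) R).of_isClosed_subset (hclosed 0) fun z hz ↦ by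
        simpa using hz.1.2) hclosed
    rw [Set.mem_iInter] at hz
    refine (hz 0).2 (hJU ?_)
    rw [frontier_eq_closure_inter_closure]
    exact ⟨subset_closure (h.mem_boundedOrbits_of_le fun n ↦ (hz n).1.2), (hz 0).1.1⟩
  refine ⟨N, fun n hn z hz ↦ ?_⟩
  have hz : ‖f^[n] z‖ = R := hz
  by_contra hzU
  refine hN ⟨z, ⟨subset_closure fun hzK ↦ ?_, hanti hn hz.le⟩, hzU⟩
  exact (h.mem_boundedOrbits_iff.mp hzK n).ne hz

/-- The level sets `‖f^[n] z‖ = R` accumulate at every point of the frontier of the set of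
bounded orbits. -/
theorem exists_levelSet_inter_nonempty (h : IsEscapeRadius f R) (hf : Continuous f) {W : Set ℂ}
    (hW : IsOpen W) {x : ℂ} (hxW : x ∈ W) (hx : x ∈ frontier (boundedOrbits f)) :
    ∃ N, ∀ n ≥ N, ({z | ‖f^[n] z‖ = R} ∩ W).Nonempty := by
  obtain ⟨ε, hε, hball⟩ := Metric.isOpen_iff.mp hW x hxW
  have hxc := hx
  rw [frontier_eq_closure_inter_closure] at hxc
  obtain ⟨y, hyK, hy⟩ := Metric.mem_closure_iff.mp hxc.2 ε hε
  obtain ⟨N, hN⟩ := h.exists_le_norm_iterate hyK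
  refine ⟨N, fun n hn ↦ ?_⟩
  obtain ⟨z, hz, hzR⟩ := (convex_ball x ε).isPreconnected.intermediate_value
    (Metric.mem_ball_self hε) (Metric.mem_ball'.mpr hy) (hf.iterate n).norm.continuousOn
    ⟨(h.mem_boundedOrbits_iff.mp (h.frontier_subset hf hx) n).le, h.le_norm_iterate hn hN⟩
  exact ⟨z, hzR, hball hz⟩

theorem isPreconnected_frontier (h : IsEscapeRadius f R) (hf : Continuous f)
    (hlevel : ∀ n, IsPreconnected {z | ‖f^[n] z‖ = R}) :
    IsPreconnected (frontier (boundedOrbits f)) := by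
  rw [isPreconnected_iff_subset_of_fully_disjoint_closed isClosed_frontier]
  intro u v hu hv huv hdisj
  obtain ⟨U, V, hU, hV, huU, hvV, hUV⟩ := normal_separation hu hv hdisj
  by_contra! hcon
  obtain ⟨⟨x, hxJ, hxu⟩, y, hyJ, hyv⟩ := hcon.imp Set.not_subset.mp Set.not_subset.mp
  obtain ⟨N₁, h₁⟩ := h.exists_levelSet_subset hf (hU.union hV)
    (huv.trans (Set.union_subset_union huU hvV))
  obtain ⟨N₂, h₂⟩ := h.exists_levelSet_inter_nonempty hf hV
    (hvV ((huv hxJ).resolve_left hxu)) hxJ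
  obtain ⟨N₃, h₃⟩ := h.exists_levelSet_inter_nonempty hf hU
    (huU ((huv hyJ).resolve_right hyv)) hyJ
  let n := max N₁ (max N₂ N₃)
  obtain ⟨z, -, hz⟩ := hlevel n U V hU hV (h₁ n (by simp [n])) (h₃ n (by simp [n]))
    (h₂ n (by simp [n]))
  exact Set.disjoint_left.mp hUV hz.1 hz.2

end IsEscapeRadius

theorem Polynomial.exists_isEscapeRadius {F : ℂ[X]} (hF : 2 ≤ F.natDegree) :
    ∃ R, IsEscapeRadius (fun z ↦ F.eval z) R := by
  have hdeg : 0 < F.divX.degree := by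
    rw [← natDegree_pos_iff_degree_pos, natDegree_divX_eq_natDegree_tsub_one]
    omega
  obtain ⟨M, -, hM⟩ := F.divX.exists_forall_le_norm_eval hdeg 3
  refine ⟨max M (‖F.coeff 0‖ + 1), by positivity, fun z hz ↦ ?_⟩
  have h1 := hM z ((le_max_left _ _).trans hz)
  have h2 := (le_max_right _ _).trans hz
  have h3 : F.eval z = F.divX.eval z * z + F.coeff 0 := by
    conv_lhs => rw [← divX_mul_X_add F]
    simp
  have h4 := norm_sub_le_norm_add (F.divX.eval z * z) (F.coeff 0)
  simp only [h3]
  rw [norm_mul] at h4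
  nlinarith [norm_nonneg z]

theorem Polynomial.eval_iterate_comp_X (F : ℂ[X]) (n : ℕ) (z : ℂ) :
    (F.comp^[n] X).eval z = (fun w ↦ F.eval w)^[n] z := by
  rw [iterate_comp_eval, eval_X]

theorem Polynomial.eval_derivative_iterate_comp_X (F : ℂ[X]) (n : ℕ) (z : ℂ) :
    (derivative (F.comp^[n] X)).eval z =
      ∏ k ∈ Finset.range n, F.derivative.eval ((fun w ↦ F.eval w)^[k] z) := by
  induction n with
  | zero => simp
  | succ n ih =>
    rw [Function.iterate_succ_apply', derivative_comp, eval_mul, eval_comp, ih,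
      eval_iterate_comp_X, Finset.prod_range_succ]

theorem Polynomial.natDegree_iterate_comp_X (F : ℂ[X]) (n : ℕ) :
    (F.comp^[n] X).natDegree = F.natDegree ^ n := by
  rw [natDegree_iterate_comp, natDegree_X, mul_one]

theorem Polynomial.nonempty_frontier_boundedOrbits {F : ℂ[X]} (hF : 2 ≤ F.natDegree) :
    (frontier (boundedOrbits fun z ↦ F.eval z)).Nonempty := by
  obtain ⟨R, hR⟩ := exists_isEscapeRadius hF
  refine nonempty_frontier_iff.mpr ⟨?_, ?_⟩
  · have hdeg : (F - X).degree ≠ 0 := by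
      refine (natDegree_pos_iff_degree_pos.mp ?_).ne'
      rw [natDegree_sub_eq_left_of_natDegree_lt] 
      · omega
      · rw [natDegree_X]
        omega
    obtain ⟨z, hz⟩ := IsAlgClosed.exists_root _ hdeg
    have hz : F.eval z = z := by simpa [sub_eq_zero] using hz
    refine ⟨z, ‖z‖, norm_nonneg _, fun n ↦ ?_⟩
    rw [Function.iterate_fixed (f := fun z ↦ F.eval z) hz]
  · exact (hR.isCompact_boundedOrbits F.continuous).ne_univ

theorem Polynomial.not_eventually_eval_eq {P : ℂ[X]} (hP : 0 < P.natDegree) (z c : ℂ) :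
    ¬ ∀ᶠ x in 𝓝 z, P.eval x = c := by
  intro h
  have hinf : {x | P.eval x = (C c).eval x}.Infinite := by
    simpa using infinite_of_mem_nhds z h
  rw [eq_of_infinite_eval_eq P (C c) hinf, natDegree_C] at hP
  exact hP.false

theorem Polynomial.isOpenMap_eval {P : ℂ[X]} (hP : 0 < P.natDegree) :
    IsOpenMap fun z ↦ P.eval z := by
  refine IsOpenMap.of_nhds_le fun z ↦ ?_
  have hana : AnalyticAt ℂ (fun z ↦ P.eval z) z := P.differentiable.analyticAt z
  exact hana.eventually_constant_or_nhds_le_map_nhds.resolve_left (P.not_eventually_eval_eq hP z _)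

/-- If `V` stays at distance at least `ε` from a connected set `J`, then `(z - a) / (z - b)` has a
holomorphic logarithm on `V` for all `a, b ∈ J`. -/
theorem IsPreconnected.exists_log_sub_div_sub {J V : Set ℂ} (hJ : IsPreconnected J) {ε : ℝ}
    (hε : 0 < ε) (hV : ∀ z ∈ V, ∀ a ∈ J, ε ≤ ‖z - a‖) {a b : ℂ} (ha : a ∈ J) (hb : b ∈ J) :
    ∃ g : ℂ → ℂ, DifferentiableOn ℂ g V ∧ ∀ z ∈ V, z - a = Complex.exp (g z) * (z - b) := by
  refine hJ.induction₂ (fun a b ↦ ∃ g : ℂ → ℂ, DifferentiableOn ℂ g V ∧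
    ∀ z ∈ V, z - a = Complex.exp (g z) * (z - b)) ?_ ?_ ?_ ha hb
  · intro x hx
    filter_upwards [self_mem_nhdsWithin, mem_nhdsWithin_of_mem_nhds (Metric.ball_mem_nhds x hε)]
      with y hy hxy
    rw [mem_ball_iff_norm] at hxy
    have hne : ∀ z ∈ V, z - y ≠ 0 := fun z hz ↦ norm_pos_iff.mp (hε.trans_le (hV z hz y hy))
    have hslit : ∀ z ∈ V, 1 + (y - x) / (z - y) ∈ Complex.slitPlane := fun z hz ↦ by
      refine Complex.mem_slitPlane_of_norm_lt_one ?_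
      rw [norm_div, div_lt_one (norm_pos_iff.mpr (hne z hz))]
      exact hxy.trans_le (hV z hz y hy)
    refine ⟨fun z ↦ Complex.log (1 + (y - x) / (z - y)), ?_, fun z hz ↦ ?_⟩
    · refine DifferentiableOn.clog ?_ hslit
      exact ((differentiableOn_const _).div (by fun_prop) hne).const_add _
    · rw [Complex.exp_log (Complex.slitPlane_ne_zero (hslit z hz))]
      have := hne z hz
      field_simp
      ring
  · rintro x y z - - - ⟨g, hg, hg'⟩ ⟨k, hk, hk'⟩
    refine ⟨fun t ↦ g t + k t, hg.add hk, fun t ht ↦ ?_⟩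
    rw [Complex.exp_add, mul_assoc, ← hk' t ht, hg' t ht]
  · rintro x y - - ⟨g, hg, hg'⟩
    refine ⟨fun t ↦ -g t, hg.neg, fun t ht ↦ ?_⟩
    rw [hg' t ht, ← mul_assoc, ← Complex.exp_add, neg_add_cancel, Complex.exp_zero, one_mul]

/-- A polynomial of degree `N` whose roots lie in a connected set `J` has a holomorphic `N`-th root
on every set at positive distance from `J`. -/
theorem Polynomial.exists_pow_eq_eval {J V : Set ℂ} (hJ : IsConnected J) {ε : ℝ}
    (hε : 0 < ε) (hV : ∀ z ∈ V, ∀ a ∈ J, ε ≤ ‖z - a‖) {Q : ℂ[X]} (hQ : 0 < Q.natDegree)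
    (hroots : ∀ a ∈ Q.roots, a ∈ J) :
    ∃ ψ : ℂ → ℂ, DifferentiableOn ℂ ψ V ∧ ∀ z ∈ V, ψ z ^ Q.natDegree = Q.eval z := by
  obtain ⟨b, hb⟩ := hJ.nonempty
  have hprod : ∀ s : Multiset ℂ, (∀ a ∈ s, a ∈ J) → ∃ h : ℂ → ℂ, DifferentiableOn ℂ h V ∧
      ∀ z ∈ V, (s.map (z - ·)).prod = Complex.exp (h z) * (z - b) ^ s.card := by
    intro s
    induction s using Multiset.induction_on with
    | empty => exact fun _ ↦ ⟨0, differentiableOn_const 0, by simp⟩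
    | cons a s ih =>
      intro hs
      obtain ⟨h, hh, hh'⟩ := ih fun x hx ↦ hs x (Multiset.mem_cons_of_mem hx)
      obtain ⟨g, hg, hg'⟩ := hJ.isPreconnected.exists_log_sub_div_sub hε hV
        (hs a (Multiset.mem_cons_self a s)) hb
      refine ⟨fun z ↦ g z + h z, hg.add hh, fun z hz ↦ ?_⟩
      rw [Multiset.map_cons, Multiset.prod_cons, hh' z hz, hg' z hz, Multiset.card_cons,
        Complex.exp_add]
      ring
  obtain ⟨h, hh, hh'⟩ := hprod Q.roots hroots
  obtain ⟨c, hc⟩ := IsAlgClosed.exists_pow_nat_eq Q.leadingCoeff hQ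
  have hsplit := IsAlgClosed.splits Q
  refine ⟨fun z ↦ c * (z - b) * Complex.exp (h z / Q.natDegree), ?_, fun z hz ↦ ?_⟩
  · exact DifferentiableOn.mul (by fun_prop) (hh.div_const _).cexp
  · have hN : (Q.natDegree : ℂ) ≠ 0 := Nat.cast_ne_zero.mpr hQ.ne'
    rw [hsplit.eval_eq_prod_roots, hh' z hz, mul_pow, mul_pow, hc, ← Complex.exp_nat_mul,
      mul_div_cancel₀ _ hN, ← hsplit.natDegree_eq_card_roots]
    ring

/-- A holomorphic `N`-th root of a polynomial of degree `N` on the exterior of one of its level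
sets takes all values of large norm. -/
theorem Polynomial.subset_image_of_pow_eq_eval {Q : ℂ[X]} (hQ : 0 < Q.natDegree) {ρ : ℝ}
    (hρ : 0 < ρ) {ψ : ℂ → ℂ} (hψ : DifferentiableOn ℂ ψ {z | ρ ^ Q.natDegree < ‖Q.eval z‖})
    (hpow : ∀ z, ρ ^ Q.natDegree < ‖Q.eval z‖ → ψ z ^ Q.natDegree = Q.eval z) :
    {w | ρ < ‖w‖} ⊆ ψ '' {z | ρ ^ Q.natDegree < ‖Q.eval z‖} := by
  have hdeg := natDegree_pos_iff_degree_pos.mp hQ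
  set O : Set ℂ := {z | ρ ^ Q.natDegree < ‖Q.eval z‖}
  have hO : IsOpen O := isOpen_lt continuous_const Q.continuous.norm
  have hnorm : ∀ z ∈ O, ρ < ‖ψ z‖ := fun z hz ↦ by
    refine lt_of_pow_lt_pow_left₀ Q.natDegree (norm_nonneg _) ?_
    rw [← norm_pow, hpow z hz]
    exact hz
  refine (isPreconnected_setOf_lt_norm hρ).subset_of_closure_inter_subset ?_ ?_ ?_
  · refine isOpen_iff_mem_nhds.mpr ?_
    rintro _ ⟨z, hz, rfl⟩
    have hana : AnalyticAt ℂ ψ z := hψ.analyticAt (hO.mem_nhds hz)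
    refine hana.eventually_constant_or_nhds_le_map_nhds.resolve_left (fun hconst ↦ ?_)
      (image_mem_map (hO.mem_nhds hz))
    refine Q.not_eventually_eval_eq hQ z (Q.eval z) ?_
    filter_upwards [hconst, hO.mem_nhds hz] with x hx hxO
    rw [← hpow x hxO, hx, hpow z hz]
  · obtain ⟨M, -, hM⟩ := Q.exists_forall_le_norm_eval hdeg (ρ ^ Q.natDegree + 1)
    have hz : (M : ℂ) ∈ O := (lt_add_one _).trans_le (hM M (by simpa using le_abs_self M))
    exact ⟨_, hnorm _ hz, Set.mem_image_of_mem ψ hz⟩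
  · rintro w ⟨hw, hwρ⟩
    have hwρ : ρ < ‖w‖ := hwρ
    obtain ⟨y, hy, hyw⟩ := mem_closure_iff_seq_limit.mp hw
    choose x hxO hxy using hy
    have hQx : Tendsto (fun n ↦ Q.eval (x n)) atTop (𝓝 (w ^ Q.natDegree)) := by
      refine (hyw.pow Q.natDegree).congr fun n ↦ ?_
      rw [← hxy, hpow _ (hxO n)]
    obtain ⟨B, hB⟩ := hQx.norm.bddAbove_range
    obtain ⟨M, -, hM⟩ := Q.exists_forall_le_norm_eval hdeg (B + 1)
    have hxM : ∀ n, x n ∈ Metric.closedBall (0 : ℂ) M := fun n ↦ by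
      rw [mem_closedBall_zero_iff]
      by_contra! hlt
      linarith [hM _ hlt.le, hB (Set.mem_range_self n)]
    obtain ⟨z, -, φ, hφ, hz⟩ := (isCompact_closedBall (0 : ℂ) M).tendsto_subseq hxM
    have hQz : Q.eval z = w ^ Q.natDegree :=
      tendsto_nhds_unique ((Q.continuous.tendsto z).comp hz) (hQx.comp hφ.tendsto_atTop)
    have hzO : z ∈ O := by
      simp only [O, Set.mem_ofPred_eq, hQz, norm_pow]
      exact pow_lt_pow_left₀ hwρ hρ.le hQ.ne'
    refine ⟨z, hzO, ?_⟩
    have hcont : ContinuousAt ψ z := hψ.continuousOn.continuousAt (hO.mem_nhds hzO)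
    refine tendsto_nhds_unique (hcont.tendsto.comp hz) ((hyw.comp hφ.tendsto_atTop).congr fun n ↦ ?_)
    exact (hxy _).symm

/-- If a polynomial of degree `N` has a holomorphic `N`-th root on the exterior of one of its level
sets, then it has no critical points there. -/
theorem Polynomial.eval_derivative_ne_zero_of_pow_eq_eval {Q : ℂ[X]} (hQ : 0 < Q.natDegree) {ρ : ℝ}
    (hρ : 0 < ρ) {ψ : ℂ → ℂ} (hψ : DifferentiableOn ℂ ψ {z | ρ ^ Q.natDegree < ‖Q.eval z‖})
    (hpow : ∀ z, ρ ^ Q.natDegree < ‖Q.eval z‖ → ψ z ^ Q.natDegree = Q.eval z) {c : ℂ}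
    (hc : ρ ^ Q.natDegree < ‖Q.eval c‖) : Q.derivative.eval c ≠ 0 := by
  intro hcrit
  have hsurj := Q.subset_image_of_pow_eq_eval hQ hρ hψ hpow
  have hw : ρ < ‖ψ c‖ := by
    refine lt_of_pow_lt_pow_left₀ Q.natDegree (norm_nonneg _) ?_
    rwa [← norm_pow, hpow c hc]
  set ζ := Complex.exp (2 * Real.pi * Complex.I / Q.natDegree)
  have hζ : IsPrimitiveRoot ζ Q.natDegree := Complex.isPrimitiveRoot_exp _ hQ.ne'
  have hex : ∀ k : Fin Q.natDegree, ∃ z, ρ ^ Q.natDegree < ‖Q.eval z‖ ∧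
      ψ z = ζ ^ (k : ℕ) * ψ c := fun k ↦
    hsurj (by simpa [hζ.norm'_eq_one hQ.ne'] using hw)
  choose x hx hxψ using hex
  have hinj : Function.Injective x := fun i j hij ↦ by
    have h1 : ζ ^ (i : ℕ) * ψ c = ζ ^ (j : ℕ) * ψ c := by rw [← hxψ, ← hxψ, hij]
    have h2 := mul_right_cancel₀ (norm_pos_iff.mp (hρ.trans hw)) h1
    exact Fin.ext (hζ.pow_inj i.2 j.2 h2)
  set T : ℂ[X] := Q - C (Q.eval c)
  have hTdeg : T.natDegree = Q.natDegree := natDegree_sub_C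
  have hT0 : T ≠ 0 := ne_zero_of_natDegree_gt (hTdeg ▸ hQ)
  have hmem : ∀ k, x k ∈ T.roots.toFinset := fun k ↦ by
    rw [Multiset.mem_toFinset, mem_roots hT0, IsRoot.def, eval_sub, eval_C, ← hpow _ (hx k),
      hxψ, mul_pow, ← pow_mul, mul_comm (k : ℕ), pow_mul, hζ.pow_eq_one, one_pow, one_mul,
      hpow c hc, sub_self]
  have hcard : Q.natDegree ≤ T.roots.toFinset.card := by
    simpa using Finset.card_le_card_of_injOn x (s := Finset.univ) (fun k _ ↦ hmem k) hinj.injOn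
  have hnodup : T.roots.Nodup := Multiset.toFinset_card_eq_card_iff_nodup.mp <|
    le_antisymm (Multiset.toFinset_card_le _) ((T.card_roots'.trans hTdeg.le).trans hcard)
  have hle := Multiset.nodup_iff_count_le_one.mp hnodup c
  rw [count_roots] at hle
  refine absurd ((one_lt_rootMultiplicity_iff_isRoot hT0 (t := c)).mpr ⟨?_, ?_⟩) (not_lt.mpr hle)
  · simp [T]
  · simpa [T] using hcrit

theorem Polynomial.mem_frontier_of_iterate_mem {F : ℂ[X]} (hF : 2 ≤ F.natDegree) {n : ℕ} {z : ℂ}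
    (hz : (fun w ↦ F.eval w)^[n] z ∈ frontier (boundedOrbits fun w ↦ F.eval w)) :
    z ∈ frontier (boundedOrbits fun w ↦ F.eval w) := by
  obtain ⟨R, hR⟩ := exists_isEscapeRadius hF
  have hopen : IsOpenMap fun z ↦ (F.comp^[n] X).eval z :=
    isOpenMap_eval (by rw [natDegree_iterate_comp_X]; positivity)
  simp only [eval_iterate_comp_X] at hopen
  have hpre := hopen.preimage_frontier_eq_frontier_preimage (F.continuous.iterate n)
    (boundedOrbits fun w ↦ F.eval w)
  have heq : (fun w ↦ F.eval w)^[n] ⁻¹' (boundedOrbits fun w ↦ F.eval w) =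
      boundedOrbits fun w ↦ F.eval w :=
    Set.ext fun z ↦ hR.iterate_mem_boundedOrbits_iff n
  rw [heq] at hpre
  exact hpre.subset hz

theorem Polynomial.mem_boundedOrbits_of_isConnected_frontier {F : ℂ[X]} (hF : 2 ≤ F.natDegree)
    (hJ : IsConnected (frontier (boundedOrbits fun z ↦ F.eval z))) {c : ℂ}
    (hc : F.derivative.eval c = 0) : c ∈ boundedOrbits fun z ↦ F.eval z := by
  by_contra hcK
  obtain ⟨R, hR⟩ := exists_isEscapeRadius hF
  have hR0 := hR.1
  obtain ⟨m, hm⟩ := hR.exists_le_norm_iterate hcK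
  obtain ⟨a, ha⟩ := hJ.nonempty
  have haR : ‖a‖ < R := hR.mem_boundedOrbits_iff.mp (hR.frontier_subset F.continuous ha) 0
  set P : ℂ[X] := F.comp^[2 + m] X
  set Q : ℂ[X] := P - C a
  have hPc : 4 * R ≤ ‖P.eval c‖ := by
    have := hR.pow_mul_le_norm_iterate hm 2
    rw [← Function.iterate_add_apply] at this
    rw [eval_iterate_comp_X]
    linarith
  have hQdeg : 0 < Q.natDegree := by
    rw [natDegree_sub_C, natDegree_iterate_comp_X]
    positivity
  set ρ : ℝ := (2 * R) ^ ((Q.natDegree : ℝ)⁻¹)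
  have hρ : 0 < ρ := by positivity
  have hρN : ρ ^ Q.natDegree = 2 * R := Real.rpow_inv_natCast_pow (by positivity) hQdeg.ne'
  have hQP : ∀ z, ‖P.eval z‖ ≤ ‖Q.eval z‖ + ‖a‖ := fun z ↦ by
    simpa [Q] using norm_add_le (Q.eval z) a
  have hPQ : ∀ z, ‖P.eval z‖ - ‖a‖ ≤ ‖Q.eval z‖ := fun z ↦ by linarith [hQP z]
  have hQP' : ∀ z, ‖Q.eval z‖ - ‖a‖ ≤ ‖P.eval z‖ := fun z ↦ by
    have := norm_sub_le (P.eval z) a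
    simp only [Q, eval_sub, eval_C]
    linarith
  obtain ⟨ε, hε, hεJ⟩ := Metric.exists_pos_forall_lt_edist (hR.isCompact_frontier F.continuous)
    (isClosed_le continuous_const P.continuous.norm : IsClosed {z | R ≤ ‖P.eval z‖}) (by
      refine Set.disjoint_left.mpr fun z hzJ hz ↦ ?_
      have hz : R ≤ ‖P.eval z‖ := hz
      rw [eval_iterate_comp_X] at hz
      exact absurd hz (not_le.mpr
        (hR.mem_boundedOrbits_iff.mp (hR.frontier_subset F.continuous hzJ) _)))
  obtain ⟨ψ, hψ, hpow⟩ := exists_pow_eq_eval (V := {z | ρ ^ Q.natDegree < ‖Q.eval z‖}) hJ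
    (NNReal.coe_pos.mpr hε) (fun z hz a haJ ↦ by
      have hz : ρ ^ Q.natDegree < ‖Q.eval z‖ := hz
      have h1 := hεJ a haJ z (by
        change R ≤ ‖P.eval z‖
        linarith [hQP' z])
      rw [edist_comm, edist_nndist, ENNReal.coe_lt_coe] at h1
      rw [← dist_eq_norm]
      exact (NNReal.coe_lt_coe.mpr h1).le) hQdeg (fun x hx ↦ by
      have hx : P.eval x = a := by
        simpa [Q, sub_eq_zero] using isRoot_of_mem_roots hx
      rw [eval_iterate_comp_X] at hx
      exact mem_frontier_of_iterate_mem hF (hx ▸ ha))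
  refine eval_derivative_ne_zero_of_pow_eq_eval hQdeg hρ hψ hpow (c := c) ?_ ?_
  · linarith [hPQ c]
  · rw [derivative_sub, derivative_C, sub_zero, eval_derivative_iterate_comp_X]
    exact Finset.prod_eq_zero (Finset.mem_range.mpr (by omega : 0 < 2 + m)) hc

theorem Polynomial.isConnected_frontier_of_forall_mem_boundedOrbits {F : ℂ[X]}
    (hF : 2 ≤ F.natDegree)
    (hcrit : ∀ c : ℂ, F.derivative.eval c = 0 → c ∈ boundedOrbits fun z ↦ F.eval z) :
    IsConnected (frontier (boundedOrbits fun z ↦ F.eval z)) := by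
  obtain ⟨R, hR⟩ := exists_isEscapeRadius hF
  refine ⟨nonempty_frontier_boundedOrbits hF,
    hR.isPreconnected_frontier F.continuous fun n ↦ ?_⟩
  simp only [← eval_iterate_comp_X]
  refine isPreconnected_setOf_norm_eval_eq (natDegree_pos_iff_degree_pos.mp ?_) hR.1 fun c hc ↦ ?_
  · rw [natDegree_iterate_comp_X]
    positivity
  · rw [eval_derivative_iterate_comp_X, Finset.prod_eq_zero_iff] at hc
    obtain ⟨k, -, hk⟩ := hc
    rw [eval_iterate_comp_X]
    exact hR.mem_boundedOrbits_iff.mp ((hR.iterate_mem_boundedOrbits_iff k).mp (hcrit _ hk)) n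

/-- For a polynomial `F` over `ℂ` of degree at least `2`, the Julia set
`J(F)` (the frontier of the filled Julia set `K(F)`) is connected iff every critical
point of `F` (every root of `F'`) has bounded forward orbit under iteration of `F`. -/
theorem juliaSet_isConnected_iff_critical_orbits_bounded (F : Polynomial ℂ)
    (hdeg : 2 ≤ F.natDegree) :
    IsConnected (frontier {z : ℂ |
        ∃ M : ℝ, 0 ≤ M ∧ ∀ n : ℕ, ‖(fun w : ℂ => F.eval w)^[n] z‖ ≤ M}) ↔
      ∀ z : ℂ, F.derivative.eval z = 0 →
        ∃ M : ℝ, 0 ≤ M ∧ ∀ n : ℕ, ‖(fun w : ℂ => F.eval w)^[n] z‖ ≤ M :=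
  ⟨fun hJ _ hz ↦ F.mem_boundedOrbits_of_isConnected_frontier hdeg hJ hz,
    fun hcrit ↦ F.isConnected_frontier_of_forall_mem_boundedOrbits hdeg hcrit⟩
end

section
/- Let F be a polynomial over ℂ of degree at least 2. If every critical point of F (every root of the derivative F′) has unbounded forward orbit under iteration of F, then the Julia set J(F), i.e. the topological frontier of the filled Julia set K(F), is a totally disconnected subset of ℂ. -/
open Filter Metric Set Topology

/-- In a Banach space, a point can be moved to any nearby point by a homeomorphism
supported in a given ball. -/
theorem exists_homeomorph_eqOn_compl_ball {E : Type*} [NormedAddCommGroup E] [NormedSpace ℝ E]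
    [CompleteSpace E] {a b : E} {ρ : ℝ} (hb : b ∈ ball a ρ) :
    ∃ φ : E ≃ₜ E, φ a = b ∧ ∀ z ∉ ball a ρ, φ z = z := by
  have hρ : 0 < ρ := nonempty_ball.1 ⟨b, hb⟩
  have hba : ‖b - a‖ < ρ := by simpa [dist_eq_norm] using hb
  obtain ⟨c, hcρ⟩ : ∃ c : NNReal, (c : ℝ) = ‖b - a‖ / ρ := ⟨⟨_, by positivity⟩, rfl⟩
  let f : E → E := fun z ↦ z + max 0 (1 - ‖z - a‖ / ρ) • (b - a)
  have hf : ApproximatesLinearOn f (ContinuousLinearEquiv.refl ℝ E : E →L[ℝ] E) univ c := by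
    intro x _ y _
    have h₁ : |max 0 (1 - ‖x - a‖ / ρ) - max 0 (1 - ‖y - a‖ / ρ)| ≤ ‖x - y‖ / ρ := by
      refine (abs_max_sub_max_le_max _ _ _ _).trans ?_
      rw [sub_self, abs_zero, max_eq_right (abs_nonneg _), sub_sub_sub_cancel_left, ← sub_div,
        abs_div, abs_of_pos hρ]
      gcongr
      refine (abs_norm_sub_norm_le _ _).trans_eq ?_
      rw [sub_sub_sub_cancel_right, norm_sub_rev]
    have h₂ : f x - f y - (ContinuousLinearEquiv.refl ℝ E : E →L[ℝ] E) (x - y) =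
        (max 0 (1 - ‖x - a‖ / ρ) - max 0 (1 - ‖y - a‖ / ρ)) • (b - a) := by
      simp only [f, ContinuousLinearEquiv.coe_refl, ContinuousLinearMap.id_apply, sub_smul]
      abel
    rw [h₂, norm_smul, Real.norm_eq_abs]
    calc _ ≤ ‖x - y‖ / ρ * ‖b - a‖ := by gcongr
      _ = c * ‖x - y‖ := by rw [hcρ]; ring
  have hc : Subsingleton E ∨
      c < ‖((ContinuousLinearEquiv.refl ℝ E).symm : E →L[ℝ] E)‖₊⁻¹ := by
    rcases subsingleton_or_nontrivial E with h | h
    · exact .inl h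
    · refine .inr ?_
      rw [ContinuousLinearEquiv.refl_symm, ContinuousLinearEquiv.coe_refl, ← NNReal.coe_lt_coe, hcρ]
      simpa using (div_lt_one hρ).2 hba
  refine ⟨hf.toHomeomorph f hc, ?_, fun z hz ↦ ?_⟩
  · change f a = b
    simp [f]
  · change f z = z
    have : 1 ≤ ‖z - a‖ / ρ := by
      rw [one_le_div hρ]
      simpa [dist_eq_norm] using hz
    simp [f, max_eq_left (sub_nonpos.2 this)]

/-- The orbit of a point under the group of homeomorphisms fixing `Z` pointwise. -/
def homeomorphOrbit {E : Type*} [TopologicalSpace E] (Z : Set E) (a : E) : Set E :=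
  {w | ∃ φ : E ≃ₜ E, (∀ z ∈ Z, φ z = z) ∧ φ a = w}

section Orbit

variable {E : Type*} [NormedAddCommGroup E] [NormedSpace ℝ E] [CompleteSpace E] {Z : Set E} {a : E}

theorem isOpen_homeomorphOrbit (hZ : IsClosed Z) (ha : a ∉ Z) :
    IsOpen (homeomorphOrbit Z a) := by
  rw [Metric.isOpen_iff]
  rintro w ⟨φ, hφ, rfl⟩
  have hw : φ a ∉ Z := fun h ↦ ha (by rwa [φ.injective (hφ _ h)] at h)
  obtain ⟨ρ, hρ, hball⟩ := Metric.isOpen_iff.1 hZ.isOpen_compl _ hw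
  refine ⟨ρ, hρ, fun b hb ↦ ?_⟩
  obtain ⟨ψ, hψa, hψ⟩ := exists_homeomorph_eqOn_compl_ball hb
  refine ⟨φ.trans ψ, fun z hz ↦ ?_, by simpa using hψa⟩
  simp only [Homeomorph.trans_apply, hφ z hz]
  exact hψ z fun h ↦ hball h hz

theorem closure_homeomorphOrbit_subset (hZ : IsClosed Z) :
    closure (homeomorphOrbit Z a) ⊆ homeomorphOrbit Z a ∪ Z := by
  intro w hw
  by_cases hwZ : w ∈ Z
  · exact .inr hwZ
  obtain ⟨ρ, hρ, hball⟩ := Metric.isOpen_iff.1 hZ.isOpen_compl _ hwZ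
  obtain ⟨b, hb, φ, hφ, rfl⟩ := mem_closure_iff.1 hw _ isOpen_ball (mem_ball_self hρ)
  obtain ⟨ψ, hψw, hψ⟩ := exists_homeomorph_eqOn_compl_ball hb
  refine .inl ⟨φ.trans ψ.symm, fun z hz ↦ ?_, by simp [← hψw]⟩
  simp only [Homeomorph.trans_apply, hφ z hz]
  rw [Homeomorph.symm_apply_eq]
  exact (hψ z fun h ↦ hball h hz).symm

theorem frontier_homeomorphOrbit_subset (hZ : IsClosed Z) (ha : a ∉ Z) :
    frontier (homeomorphOrbit Z a) ⊆ Z := by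
  rw [(isOpen_homeomorphOrbit hZ ha).frontier_eq]
  rintro w ⟨hw, hw'⟩
  exact (closure_homeomorphOrbit_subset hZ hw).resolve_left hw'

/-- If the closed set `K` fills its bounded complementary components in `closedBall 0 R`, then
finitely many points of `ball 0 (R + 1) \ K` can be pushed out of `closedBall 0 R` by a
homeomorphism fixing `K` and the complement of `ball 0 (R + 1)`. -/
theorem exists_homeomorph_forall_notMem_closedBall {K : Set E} {R : ℝ} (hK : IsClosed K)
    (hfill : ∀ O : Set E, IsOpen O → O ⊆ closedBall 0 R → frontier O ⊆ K → O ⊆ K)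
    {S : Set E} (hS : S.Finite) (hSK : Disjoint S (K ∪ (ball 0 (R + 1))ᶜ)) :
    ∃ φ : E ≃ₜ E, (∀ z ∈ K ∪ (ball 0 (R + 1))ᶜ, φ z = z) ∧ ∀ s ∈ S, φ s ∉ closedBall 0 R := by
  induction S, hS using Set.Finite.induction_on with
  | empty => exact ⟨.refl E, by simp, by simp⟩
  | @insert s S hs hSfin ih =>
    rw [disjoint_insert_left] at hSK
    obtain ⟨φ, hφ, hφS⟩ := ih hSK.2
    set Z := K ∪ (ball 0 (R + 1))ᶜ ∪ φ '' S with hZdef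
    have hZ : IsClosed Z :=
      (hK.union isOpen_ball.isClosed_compl).union (hSfin.image φ).isClosed
    have hsZ : φ s ∉ Z := by
      rintro (h | ⟨t, ht, h⟩)
      · exact hSK.1 (by rwa [φ.injective (hφ _ h)] at h)
      · exact hs (φ.injective h ▸ ht)
    obtain ⟨w, ⟨ψ, hψ, rfl⟩, hw⟩ : ∃ w ∈ homeomorphOrbit Z (φ s), w ∉ closedBall 0 R := by
      by_contra! hsub
      have hmem : φ s ∈ homeomorphOrbit Z (φ s) := ⟨.refl E, by simp, rfl⟩
      refine hsZ (.inl (.inl (hfill _ (isOpen_homeomorphOrbit hZ hsZ) hsub (fun z hz ↦ ?_) hmem)))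
      have hzR : z ∈ closedBall 0 R :=
        closure_minimal hsub isClosed_closedBall (frontier_subset_closure hz)
      rcases frontier_homeomorphOrbit_subset hZ hsZ hz with (h | h) | ⟨t, ht, rfl⟩
      · exact h
      · exact absurd (closedBall_subset_ball (by linarith) hzR) h
      · exact absurd hzR (hφS t ht)
    refine ⟨φ.trans ψ, fun z hz ↦ ?_, ?_⟩
    · simp only [Homeomorph.trans_apply, hφ z hz]
      exact hψ z (.inl hz)
    · rintro t (rfl | ht)
      · exact hw
      · simp only [Homeomorph.trans_apply, hψ _ (.inr (mem_image_of_mem φ ht))]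
        exact hφS t ht

end Orbit

/-- Vitali–Montel: a pointwise limit of a uniformly bounded family of holomorphic functions
is locally uniform. -/
theorem tendstoLocallyUniformlyOn_of_differentiableOn_of_norm_le {ι : Type*} {l : Filter ι}
    {g : ι → ℂ → ℂ} {G : ℂ → ℂ} {W : Set ℂ} {R : ℝ} (hW : IsOpen W)
    (hg : ∀ i, DifferentiableOn ℂ (g i) W) (hR : ∀ i, ∀ z ∈ W, ‖g i z‖ ≤ R)
    (hG : ∀ z ∈ W, Tendsto (fun i ↦ g i z) l (𝓝 (G z))) :
    TendstoLocallyUniformlyOn g G l W := by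
  have heq : ∀ w ∈ W, EquicontinuousAt g w := by
    intro w hw
    obtain ⟨ρ, hρ, hball⟩ := Metric.isOpen_iff.1 hW w hw
    refine Metric.equicontinuousAt_of_continuity_modulus (fun z ↦ 2 * R / ρ * dist z w) ?_ _ ?_
    · have : Continuous fun z ↦ 2 * R / ρ * dist z w := by fun_prop
      simpa using this.tendsto w
    · filter_upwards [ball_mem_nhds w hρ] with z hz i
      rw [dist_comm]
      refine Complex.dist_le_div_mul_dist_of_mapsTo_ball ((hg i).mono hball) (fun x hx ↦ ?_) hz
      rw [mem_closedBall, dist_eq_norm]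
      linarith [norm_sub_le (g i x) (g i w), hR i x (hball hx), hR i w hw]
  rw [tendstoLocallyUniformlyOn_iff_forall_isCompact hW]
  intro K hKW hK
  have := (EquicontinuousOn.tendsto_uniformOnFun_iff_pi' (F := g) (𝔖 := {K}) (by simpa)
    (by rintro _ rfl w hw; exact (heq w (hKW hw)).equicontinuousWithinAt _) l G).2 (by
      rw [tendsto_pi_nhds]
      rintro ⟨x, hx⟩
      exact hG x (hKW (by simpa using hx)))
  exact UniformOnFun.tendsto_iff_tendstoUniformlyOn.1 this K rfl

/-- Holomorphic right inverses of the iterates of `f`, uniformly bounded on a domain `W` some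
open part of which leaves `W` under iteration, contract the compact subsets of `W`. -/
theorem eq_of_forall_iterate_rightInverse {f : ℂ → ℂ} {g : ℕ → ℂ → ℂ} {W K : Set ℂ} {R : ℝ}
    (hW : IsOpen W) (hWc : IsPreconnected W)
    (hg : ∀ n, DifferentiableOn ℂ (g n) W) (hR : ∀ n, ∀ z ∈ W, ‖g n z‖ ≤ R)
    (hfg : ∀ n, ∀ z ∈ W, f^[n] (g n z) = z)
    {y : ℂ} (hy : y ∈ W) {N : ℕ} (hesc : ∀ᶠ x in 𝓝 y, ∀ k ≥ N, f^[k] x ∉ W)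
    (hK : IsCompact K) (hKW : K ⊆ W) {u v : ℕ → ℂ} (hu : ∀ n, u n ∈ K) (hv : ∀ n, v n ∈ K)
    {a b : ℂ} (ha : ∀ n, g n (u n) = a) (hb : ∀ n, g n (v n) = b) : a = b := by
  let l : Ultrafilter ℕ := hyperfilter ℕ
  have hl : (l : Filter ℕ) ≤ atTop := Nat.hyperfilter_le_atTop
  have hlim : ∀ z ∈ W, ∃ c, Tendsto (fun n ↦ g n z) l (𝓝 c) := by
    intro z hz
    obtain ⟨c, -, hc⟩ := (isCompact_closedBall (0 : ℂ) R).ultrafilter_le_nhds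
      (l.map fun n ↦ g n z) (by
        rw [le_principal_iff]
        exact Ultrafilter.mem_map.2 (univ_mem' fun n ↦ by simpa using hR n z hz))
    exact ⟨c, hc⟩
  choose! G hG using hlim
  have hunif := tendstoLocallyUniformlyOn_of_differentiableOn_of_norm_le hW hg hR hG
  have hGd : DifferentiableOn ℂ G W := hunif.differentiableOn (.of_forall hg) hW
  have hGan : AnalyticOnNhd ℂ G W := hGd.analyticOnNhd hW
  have hconst : ∀ᶠ z in 𝓝 y, G z = G y := by
    refine ((hGan y hy).eventually_eq_or_eventually_ne analyticAt_const).resolve_right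
      fun hne ↦ ?_
    rw [eventually_nhdsWithin_iff] at hne
    obtain ⟨ρ, hρ, hball⟩ := Metric.eventually_nhds_iff_ball.1
      (hne.and ((hW.eventually_mem hy).and hesc))
    set r := ρ / 2 with hr
    have hr₀ : 0 < r := by positivity
    have hcb : closedBall y r ⊆ ball y ρ := closedBall_subset_ball (by linarith)
    have hcW : closedBall y r ⊆ W := fun z hz ↦ (hball z (hcb hz)).2.1
    have hsph : IsCompact (sphere y r) := isCompact_sphere y r
    obtain ⟨z₀, hz₀, hmin⟩ := hsph.exists_isMinOn (NormedSpace.sphere_nonempty.2 hr₀.le)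
      (f := fun z ↦ ‖G z - G y‖)
      ((hGd.continuousOn.mono (sphere_subset_closedBall.trans hcW)).sub continuousOn_const).norm
    have hε : 0 < ‖G z₀ - G y‖ := by
      rw [norm_pos_iff, sub_ne_zero]
      exact (hball z₀ (hcb (sphere_subset_closedBall hz₀))).1 (ne_of_mem_sphere hz₀ hr₀.ne')
    set ε := ‖G z₀ - G y‖ / 2 with hεdef
    have hε₀ : 0 < ε := by positivity
    have hclose := Metric.tendstoUniformlyOn_iff.1
      ((tendstoLocallyUniformlyOn_iff_forall_isCompact hW).1 hunif _ hcW
        (isCompact_closedBall y r)) (ε / 2) (by positivity)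
    have hhit : ∀ᶠ n in (l : Filter ℕ), f^[n] (G y) ∈ closedBall y r := by
      filter_upwards [hclose] with n hn
      have hny := hn y (mem_closedBall_self hr₀.le)
      have hlow : ∀ z ∈ sphere y r, ε ≤ ‖g n z - g n y‖ := by
        intro z hz
        have h₁ := hn z (sphere_subset_closedBall hz)
        have h₂ : ‖G z₀ - G y‖ ≤ ‖G z - G y‖ := hmin hz
        have h₃ := dist_triangle4 (G z) (g n z) (g n y) (G y)
        rw [dist_comm (g n y), dist_eq_norm (G z) (G y), dist_eq_norm (g n z) (g n y)] at h₃
        linarith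
      have hdc : DiffContOnCl ℂ (g n) (ball y r) :=
        ((hg n).mono (hcW.trans' closure_ball_subset_closedBall)).diffContOnCl
      have hfreq : ∃ᶠ z in 𝓝 y, g n z ≠ g n y := by
        refine Eventually.frequently (f := 𝓝[≠] y) ?_ |>.filter_mono nhdsWithin_le_nhds
        filter_upwards [self_mem_nhdsWithin, mem_nhdsWithin_of_mem_nhds (hW.mem_nhds hy)]
          with z hz hzW h
        exact hz (by rw [mem_singleton_iff, ← hfg n z hzW, h, hfg n y hy])
      obtain ⟨x, hx, hxG⟩ := hdc.ball_subset_image_closedBall hr₀ hlow hfreq hny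
      rw [← hxG, hfg n x (hcW hx)]
      exact hx
    obtain ⟨n, hn⟩ := hhit.exists
    obtain ⟨m, hm, hnm⟩ := (hhit.and (hl (eventually_ge_atTop (n + N)))).exists
    refine (hball _ (hcb hn)).2.2 (m - n) (by omega) ?_
    rw [← Function.iterate_add_apply, Nat.sub_add_cancel (by omega)]
    exact hcW hm
  have hGy : EqOn G (fun _ ↦ G y) W :=
    hGan.eqOn_of_preconnected_of_eventuallyEq analyticOnNhd_const hWc hy hconst
  have key : ∀ (w : ℕ → ℂ) (c : ℂ), (∀ n, w n ∈ K) → (∀ n, g n (w n) = c) → c = G y := by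
    intro w c hw hc
    obtain ⟨w₀, hw₀, hlw⟩ := hK.ultrafilter_le_nhds (l.map w) (by
      rw [le_principal_iff]
      exact Ultrafilter.mem_map.2 (univ_mem' hw))
    have h := (tendstoLocallyUniformlyOn_iff_forall_isCompact hW).1 hunif K hKW hK
    have h' : Tendsto (fun n ↦ g n (w n)) l (𝓝 (G w₀)) :=
      h.tendsto_comp ((hGd.continuousOn.mono hKW) w₀ hw₀)
        (tendsto_nhdsWithin_iff.2 ⟨hlw, .of_forall hw⟩)
    simp only [hc] at h'
    rw [tendsto_nhds_unique tendsto_const_nhds h', hGy (hKW hw₀)]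
  rw [key u a hu ha, key v b hv hb]

/-- Inverse branches of a polynomial on a simply connected open set without critical values. -/
theorem Polynomial.exists_differentiableOn_rightInverse (p : Polynomial ℂ) {W : Set ℂ}
    (hW : IsOpen W) [SimplyConnectedSpace W]
    (hp : ∀ c, p.derivative.eval c = 0 → p.eval c ∉ W) {z₀ : ℂ} (hz₀ : p.eval z₀ ∈ W) :
    ∃ g : ℂ → ℂ, DifferentiableOn ℂ g W ∧ (∀ z ∈ W, p.eval (g z) = z) ∧
      ∀ t : Set ℂ, IsPreconnected t → z₀ ∈ t → MapsTo p.eval t W →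
        ∀ z ∈ t, g (p.eval z) = z := by
  have hcov : IsCoveringMapOn p.eval W := p.isCoveringMapOn_eval.mono <| by
    rintro z hz ⟨c, hc, rfl⟩
    exact hp c hc hz
  have := hW.locallyPathConnectedSpace
  obtain ⟨G, ⟨hG₀, hG⟩, -⟩ := hcov.isCoveringMap_restrictPreimage.existsUnique_continuousMap_lifts
    (ContinuousMap.id W) ⟨_, hz₀⟩ ⟨z₀, hz₀⟩ rfl
  have hpG : ∀ z : W, p.eval (G z : ℂ) = z := fun z ↦ congrArg Subtype.val (congrFun hG z)
  classical
  let g : ℂ → ℂ := fun z ↦ if h : z ∈ W then G ⟨z, h⟩ else 0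
  have hgG : ∀ z (h : z ∈ W), g z = G ⟨z, h⟩ := fun z h ↦ dif_pos h
  have hpg : ∀ z ∈ W, p.eval (g z) = z := fun z h ↦ by rw [hgG z h, hpG]
  have hcont : ContinuousOn g W := by
    rw [continuousOn_iff_continuous_domRestrict]
    have : W.domRestrict g = fun z ↦ (G z : ℂ) := _root_.funext fun z ↦ hgG z z.2
    rw [this]
    fun_prop
  refine ⟨g, fun z hz ↦ ?_, hpg, fun t ht hz₀t hmaps z hz ↦ ?_⟩
  · refine (HasStrictDerivAt.of_local_left_inverse (f := p.eval)
      (hcont.continuousAt (hW.mem_nhds hz)) (p.hasStrictDerivAt _)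
      (fun h ↦ hp _ h (by rwa [hpg z hz])) ?_).hasDerivAt.differentiableAt.differentiableWithinAt
    filter_upwards [hW.mem_nhds hz] with w hw using hpg w hw
  · have : PreconnectedSpace t := isPreconnected_iff_preconnectedSpace.1 ht
    have h := hcov.isCoveringMap_restrictPreimage.eq_of_comp_eq (A := t)
      (g₁ := fun x ↦ G ⟨p.eval x, hmaps x.2⟩) (g₂ := fun x ↦ ⟨x, hmaps x.2⟩)
      (by fun_prop) (by fun_prop)
      (_root_.funext fun x ↦ congrFun hG ⟨p.eval x, hmaps x.2⟩) ⟨z₀, hz₀t⟩ hG₀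
    rw [hgG _ (hmaps hz)]
    exact congrArg Subtype.val (congrFun h ⟨z, hz⟩)

/-- The critical values of an iterate of `p` are forward images of critical points of `p`. -/
theorem Polynomial.exists_iterate_eq_of_derivative_iterate_comp_eval_eq_zero
    (p : Polynomial ℂ) (n : ℕ) {z : ℂ}
    (hz : (Polynomial.derivative (p.comp^[n] Polynomial.X)).eval z = 0) :
    ∃ c, p.derivative.eval c = 0 ∧
      ∃ k, (fun w ↦ p.eval w)^[k + 1] c = (p.comp^[n] Polynomial.X).eval z := by
  induction n with
  | zero => simp at hz
  | succ n ih =>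
    rw [Function.iterate_succ_apply'] at hz ⊢
    rw [Polynomial.derivative_comp, Polynomial.eval_mul, Polynomial.eval_comp, mul_eq_zero] at hz
    rw [Polynomial.eval_comp]
    rcases hz with hz | hz
    · obtain ⟨c, hc, k, hk⟩ := ih hz
      exact ⟨c, hc, k + 1, by rw [Function.iterate_succ_apply', hk]⟩
    · exact ⟨_, hz, 0, rfl⟩

theorem Polynomial.exists_forall_two_mul_norm_le_norm_eval (F : Polynomial ℂ)
    (hdeg : 2 ≤ F.natDegree) :
    ∃ R : ℝ, 1 ≤ R ∧ ∀ z : ℂ, R ≤ ‖z‖ → 2 * ‖z‖ ≤ ‖F.eval z‖ := by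
  have hdiv : 0 < F.divX.degree := by
    rw [← Polynomial.natDegree_pos_iff_degree_pos, Polynomial.natDegree_divX_eq_natDegree_tsub_one]
    omega
  have htend := F.divX.tendsto_norm_atTop hdiv (tendsto_norm_cobounded_atTop (E := ℂ))
  have hev := htend.eventually_ge_atTop (2 + ‖F.coeff 0‖)
  rw [← comap_norm_atTop, eventually_comap] at hev
  obtain ⟨R, hR⟩ := eventually_atTop.1 hev
  refine ⟨max R 1, le_max_right _ _, fun z hz ↦ ?_⟩
  have h₁ := hR ‖z‖ ((le_max_left _ _).trans hz) z rfl
  have h₂ : 1 ≤ ‖z‖ := (le_max_right _ _).trans hz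
  have h₃ : F.eval z = F.divX.eval z * z + F.coeff 0 := by
    conv_lhs => rw [← F.divX_mul_X_add]
    simp
  have h₄ := norm_sub_le (F.divX.eval z * z + F.coeff 0) (F.coeff 0)
  rw [add_sub_cancel_right, ← h₃, norm_mul] at h₄
  nlinarith [norm_nonneg (F.coeff 0)]

section Escape

variable {f : ℂ → ℂ} {R : ℝ}

theorem two_pow_mul_norm_le_norm_iterate (hf : ∀ z, R ≤ ‖z‖ → 2 * ‖z‖ ≤ ‖f z‖)
    {z : ℂ} (hz : R ≤ ‖z‖) (n : ℕ) : 2 ^ n * ‖z‖ ≤ ‖f^[n] z‖ := by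
  induction n with
  | zero => simp
  | succ n ih =>
    have h : ‖z‖ ≤ 2 ^ n * ‖z‖ := le_mul_of_one_le_left (norm_nonneg z) (one_le_pow₀ one_le_two)
    rw [Function.iterate_succ_apply', pow_succ']
    linarith [hf _ (hz.trans (h.trans ih))]

theorem norm_le_norm_iterate (hf : ∀ z, R ≤ ‖z‖ → 2 * ‖z‖ ≤ ‖f z‖)
    {z : ℂ} (hz : R ≤ ‖z‖) (n : ℕ) : ‖z‖ ≤ ‖f^[n] z‖ :=
  (le_mul_of_one_le_left (norm_nonneg z) (one_le_pow₀ one_le_two)).trans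
    (two_pow_mul_norm_le_norm_iterate hf hz n)

theorem norm_iterate_lt_of_bounded (hR : 1 ≤ R) (hf : ∀ z, R ≤ ‖z‖ → 2 * ‖z‖ ≤ ‖f z‖)
    {z : ℂ} {M : ℝ} (hM : ∀ n : ℕ, ‖f^[n] z‖ ≤ M) (n : ℕ) : ‖f^[n] z‖ < R := by
  by_contra! hn
  obtain ⟨k, hk⟩ := pow_unbounded_of_one_lt M one_lt_two
  have h₁ := two_pow_mul_norm_le_norm_iterate hf hn k
  rw [← Function.iterate_add_apply] at h₁
  have h₂ : (2 : ℝ) ^ k ≤ 2 ^ k * ‖f^[n] z‖ :=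
    le_mul_of_one_le_right (by positivity) (hR.trans hn)
  linarith [hM (k + n)]

/-- A bounded open set whose boundary has uniformly bounded orbits has uniformly bounded orbits. -/
theorem norm_iterate_le_of_frontier {O : Set ℂ} (hfd : Differentiable ℂ f)
    (hO : Bornology.IsBounded O) (hfr : ∀ z ∈ frontier O, ∀ n : ℕ, ‖f^[n] z‖ ≤ R)
    {z : ℂ} (hz : z ∈ O) (n : ℕ) : ‖f^[n] z‖ ≤ R :=
  Complex.norm_le_of_forall_mem_frontier_norm_le hO (hfd.iterate n).diffContOnCl
    (fun w hw ↦ hfr w hw n) (subset_closure hz)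

end Escape

/-- A finite set of points with unbounded orbits visits a bounded set finitely often. -/
theorem finite_setOf_iterate_inter_ball {f : ℂ → ℂ} {R : ℝ}
    (hf : ∀ z, R ≤ ‖z‖ → 2 * ‖z‖ ≤ ‖f z‖) {C : Set ℂ} (hC : C.Finite)
    (hesc : ∀ c ∈ C, ∃ n : ℕ, R + 1 ≤ ‖f^[n] c‖) :
    ({w | ∃ c ∈ C, ∃ k, f^[k + 1] c = w} ∩ ball 0 (R + 1)).Finite := by
  choose! N hN using hesc
  refine (hC.biUnion fun c _ ↦ (finite_Iio (N c)).image fun k ↦ f^[k] c).subset ?_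
  rintro _ ⟨⟨c, hc, k, rfl⟩, hk⟩
  refine mem_biUnion hc ⟨k + 1, ?_, rfl⟩
  by_contra h
  have h₁ := norm_le_norm_iterate hf (by linarith [hN c hc] : R ≤ ‖f^[N c] c‖) (k + 1 - N c)
  rw [← Function.iterate_add_apply, Nat.sub_add_cancel (not_lt.1 h)] at h₁
  rw [mem_ball_zero_iff] at hk
  linarith [hN c hc]

/-- For a polynomial `F` over `ℂ` of degree at least `2`, if every
critical point of `F` (every root of `F'`) has unbounded forward orbit under iteration
of `F`, then the Julia set `J(F)` (the frontier of the filled Julia set `K(F)`) is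
totally disconnected. -/
theorem juliaSet_totallyDisconnected_of_critical_orbits_unbounded (F : Polynomial ℂ)
    (hdeg : 2 ≤ F.natDegree)
    (hcrit : ∀ z : ℂ, F.derivative.eval z = 0 →
      ¬ ∃ M : ℝ, 0 ≤ M ∧ ∀ n : ℕ, ‖(fun w : ℂ => F.eval w)^[n] z‖ ≤ M) :
    IsTotallyDisconnected (frontier {z : ℂ |
      ∃ M : ℝ, 0 ≤ M ∧ ∀ n : ℕ, ‖(fun w : ℂ => F.eval w)^[n] z‖ ≤ M}) := by
  obtain ⟨R, hR, hf⟩ := F.exists_forall_two_mul_norm_le_norm_eval hdeg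
  set f : ℂ → ℂ := fun w ↦ F.eval w
  set K : Set ℂ := {z | ∃ M : ℝ, 0 ≤ M ∧ ∀ n : ℕ, ‖f^[n] z‖ ≤ M}
  have hfd : Differentiable ℂ f := F.differentiable
  have hKlt : ∀ z ∈ K, ∀ n : ℕ, ‖f^[n] z‖ < R := by
    rintro z ⟨M, -, hM⟩
    exact norm_iterate_lt_of_bounded hR hf hM
  have hKle : ∀ (M : ℝ), 0 ≤ M → ∀ z ∉ K, ∃ n : ℕ, M < ‖f^[n] z‖ := by
    intro M hM z hz
    by_contra! h
    exact hz ⟨M, hM, h⟩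
  have hKball : K ⊆ ball 0 R := fun z hz ↦ by simpa using hKlt z hz 0
  have hKclosed : IsClosed K := by
    have : K = ⋂ n : ℕ, {z | ‖f^[n] z‖ ≤ R} := by
      ext z
      rw [mem_iInter]
      exact ⟨fun hz n ↦ (hKlt z hz n).le, fun hz ↦ ⟨R, by linarith, hz⟩⟩
    rw [this]
    exact isClosed_iInter fun n ↦ isClosed_le (hfd.continuous.iterate n).norm continuous_const
  have hKcompact : IsCompact K :=
    (isCompact_closedBall 0 R).of_isClosed_subset hKclosed (hKball.trans ball_subset_closedBall)
  have hfill : ∀ O : Set ℂ, IsOpen O → O ⊆ closedBall 0 R → frontier O ⊆ K → O ⊆ K :=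
    fun O _ hOR hOK z hz ↦ ⟨R, by linarith, norm_iterate_le_of_frontier hfd
      (isBounded_closedBall.subset hOR) (fun w hw n ↦ (hKlt w (hOK hw) n).le) hz⟩
  have hF' : F.derivative ≠ 0 := by
    intro h
    have := Polynomial.derivative_eq_zero.1 h
    omega
  have hC : {c | F.derivative.eval c = 0}.Finite := Polynomial.finite_setOfPred_isRoot hF'
  obtain ⟨φ, hφ, hφS⟩ := exists_homeomorph_forall_notMem_closedBall hKclosed hfill
    (finite_setOf_iterate_inter_ball hf hC fun c hc ↦
      (hKle (R + 1) (by linarith) c (hcrit c hc)).imp fun _ h ↦ h.le) <| by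
    rw [disjoint_left]
    rintro _ ⟨⟨c, hc, k, rfl⟩, hk⟩ (⟨M, -, hM⟩ | h)
    · obtain ⟨n, hn⟩ := hKle R (by linarith) c (hcrit c hc)
      have h₁ := norm_le_norm_iterate hf hn.le (k + 1)
      rw [← Function.iterate_add_apply, add_comm, Function.iterate_add_apply] at h₁
      linarith [norm_iterate_lt_of_bounded hR hf hM n]
    · exact h hk
  set W : Set ℂ := φ ⁻¹' ball 0 R with hWdef
  have hWo : IsOpen W := isOpen_ball.preimage φ.continuous
  have hKW : K ⊆ W := fun z hz ↦ by
    rw [hWdef, mem_preimage, hφ z (.inl hz)]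
    exact hKball hz
  have hWball : W ⊆ ball 0 (R + 1) := by
    intro z hz
    by_contra h
    rw [hWdef, mem_preimage, hφ z (.inr h)] at hz
    exact h (ball_subset_ball (by linarith) hz)
  have : ContractibleSpace (ball (0 : ℂ) R) :=
    (convex_ball 0 R).contractibleSpace ⟨0, mem_ball_self (by linarith)⟩
  have : ContractibleSpace W := (φ.sets rfl).contractibleSpace
  have hWc : IsPreconnected W := isPreconnected_iff_preconnectedSpace.2 inferInstance
  have hWcrit : ∀ c, F.derivative.eval c = 0 → ∀ k, f^[k + 1] c ∉ W := fun c hc k h ↦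
    hφS _ ⟨⟨c, hc, k, rfl⟩, hWball h⟩ (ball_subset_closedBall h)
  intro t ht htc z₀ hz₀ z₁ hz₁
  have htK : t ⊆ K := ht.trans hKclosed.frontier_subset
  have hiter : ∀ z ∈ K, ∀ n : ℕ, f^[n] z ∈ K := by
    rintro z ⟨M, hM₀, hM⟩ n
    exact ⟨M, hM₀, fun m ↦ by rw [← Function.iterate_add_apply]; exact hM _⟩
  have heval : ∀ (n : ℕ) z, (F.comp^[n] Polynomial.X).eval z = f^[n] z := fun n z ↦ by
    rw [Polynomial.iterate_comp_eval, Polynomial.eval_X]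
  have hbranch := fun n : ℕ ↦ (F.comp^[n] Polynomial.X).exists_differentiableOn_rightInverse hWo
    (fun c hc ↦ by
      obtain ⟨b, hb, k, hk⟩ := F.exists_iterate_eq_of_derivative_iterate_comp_eval_eq_zero n hc
      exact hk ▸ hWcrit b hb k)
    (z₀ := z₀) (by rw [heval]; exact hKW (hiter z₀ (htK hz₀) n))
  simp only [heval] at hbranch
  choose g hgd hfg hgt using hbranch
  have hginv : ∀ n, ∀ z ∈ t, g n (f^[n] z) = z := fun n ↦
    hgt n t htc hz₀ fun z hz ↦ by simpa only [heval] using hKW (hiter z (htK hz) n)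
  obtain ⟨y, hyW, hyK⟩ : ∃ y ∈ W, y ∉ K := by
    by_contra! h
    have hWK : W = K := Subset.antisymm h hKW
    rcases isClopen_iff.1 ⟨hKclosed, hWK ▸ hWo⟩ with h₀ | h₁
    · exact (h₀ ▸ htK hz₀ : z₀ ∈ (∅ : Set ℂ))
    · have := hKball (h₁ ▸ mem_univ (R : ℂ))
      rw [mem_ball_zero_iff, Complex.norm_of_nonneg (by linarith)] at this
      exact this.false
  obtain ⟨N, hN⟩ := hKle (R + 1) (by linarith) y hyK
  refine eq_of_forall_iterate_rightInverse (R := R + 1) hWo hWc hgd (fun n z hz ↦ ?_) hfg hyW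
    (N := N) ?_ hKcompact hKW (fun n ↦ hiter z₀ (htK hz₀) n) (fun n ↦ hiter z₁ (htK hz₁) n)
    (fun n ↦ hginv n z₀ hz₀) (fun n ↦ hginv n z₁ hz₁)
  · by_contra! h
    have h₁ := norm_le_norm_iterate hf (by linarith : R ≤ ‖g n z‖) n
    rw [hfg n z hz] at h₁
    linarith [mem_ball_zero_iff.1 (hWball hz)]
  · filter_upwards [(hfd.continuous.iterate N).norm.continuousAt.eventually_const_lt hN]
      with x hx k hk hxW
    have h₁ := norm_le_norm_iterate hf (by linarith : R ≤ ‖f^[N] x‖) (k - N)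
    rw [← Function.iterate_add_apply, Nat.sub_add_cancel hk] at h₁
    linarith [mem_ball_zero_iff.1 (hWball hxW)]
end

section
/- Let c₁, c₂ ∈ ℂ and let F(z) = (z² + c₁)² + c₂. If the forward orbit of 0 under F is unbounded, or the forward orbit of some w ∈ ℂ with w² = −c₁ under F is unbounded, then the alternated Julia set, i.e. the topological frontier of the alternated filled Julia set K_{c₁c₂}, is not a connected subset of ℂ. -/
/-- The alternated filled Julia set. -/
def altFilledJulia (c₁ c₂ : ℂ) : Set ℂ :=
  {z₀ : ℂ | ∃ M : ℝ, 0 ≤ M ∧ ∀ n : ℕ, ‖altOrbit c₁ c₂ z₀ n‖ ≤ M}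

/-- An escape radius for the alternated iteration. -/
noncomputable def escapeRadius (c₁ c₂ : ℂ) : ℝ := 2 + ‖c₁‖ + ‖c₂‖

theorem altOrbit_succ_left (c₁ c₂ z : ℂ) (n : ℕ) :
    altOrbit c₁ c₂ z (n + 1) = altOrbit c₂ c₁ (z ^ 2 + c₁) n := by
  induction n with
  | zero => simp [altOrbit]
  | succ n ih =>
    rw [altOrbit, ih, altOrbit]
    by_cases hn : Even n <;> simp [hn, Nat.even_add_one]

theorem iterate_eq_altOrbit (c₁ c₂ z : ℂ) (n : ℕ) :
    (fun z : ℂ => (z ^ 2 + c₁) ^ 2 + c₂)^[n] z = altOrbit c₁ c₂ z (2 * n) := by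
  induction n with
  | zero => simp [altOrbit]
  | succ n ih =>
    rw [Function.iterate_succ_apply', ih, Nat.mul_succ, altOrbit, altOrbit]
    simp

theorem differentiable_altOrbit (c₁ c₂ : ℂ) (n : ℕ) :
    Differentiable ℂ fun z => altOrbit c₁ c₂ z n := by
  induction n with
  | zero => simp [altOrbit]
  | succ n ih => exact (ih.pow 2).add_const _

theorem mem_altFilledJulia_iff_sq_add_mem (c₁ c₂ z : ℂ) :
    z ∈ altFilledJulia c₁ c₂ ↔ z ^ 2 + c₁ ∈ altFilledJulia c₂ c₁ := by
  constructor
  · rintro ⟨M, hM, h⟩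
    exact ⟨M, hM, fun n => altOrbit_succ_left c₁ c₂ z n ▸ h (n + 1)⟩
  · rintro ⟨M, hM, h⟩
    refine ⟨max M ‖z‖, le_max_of_le_left hM, fun n => ?_⟩
    cases n with
    | zero => exact le_max_right _ _
    | succ n => exact altOrbit_succ_left c₁ c₂ z n ▸ le_max_of_le_left (h n)

theorem two_mul_norm_altOrbit_le {c₁ c₂ z : ℂ} {n : ℕ}
    (h : escapeRadius c₁ c₂ < ‖altOrbit c₁ c₂ z n‖) :
    2 * ‖altOrbit c₁ c₂ z n‖ ≤ ‖altOrbit c₁ c₂ z (n + 1)‖ := by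
  rw [altOrbit]
  unfold escapeRadius at h
  set w := altOrbit c₁ c₂ z n
  set c := if Even n then c₁ else c₂
  have hc : ‖c‖ ≤ ‖c₁‖ + ‖c₂‖ := by
    dsimp only [c]
    split_ifs <;> linarith [norm_nonneg c₁, norm_nonneg c₂]
  have h₁ : ‖w‖ ^ 2 - ‖c‖ ≤ ‖w ^ 2 + c‖ := by
    have := norm_sub_norm_le (w ^ 2) (-c)
    rwa [norm_neg, sub_neg_eq_add, norm_pow] at this
  nlinarith [norm_nonneg c₁, norm_nonneg c₂]

theorem norm_altOrbit_le_escapeRadius {c₁ c₂ z : ℂ} (hz : z ∈ altFilledJulia c₁ c₂) (n : ℕ) :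
    ‖altOrbit c₁ c₂ z n‖ ≤ escapeRadius c₁ c₂ := by
  by_contra! hn
  obtain ⟨M, -, hM⟩ := hz
  have hR : 2 ≤ escapeRadius c₁ c₂ := by
    unfold escapeRadius
    linarith [norm_nonneg c₁, norm_nonneg c₂]
  have grow : ∀ k : ℕ, escapeRadius c₁ c₂ < ‖altOrbit c₁ c₂ z (n + k)‖ ∧
      (k : ℝ) ≤ ‖altOrbit c₁ c₂ z (n + k)‖ := by
    intro k
    induction k with
    | zero => exact ⟨hn, by simp⟩
    | succ k ih =>
      have := two_mul_norm_altOrbit_le ih.1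
      rw [← Nat.add_assoc]
      push_cast
      exact ⟨by linarith, by linarith⟩
  obtain ⟨k, hk⟩ := exists_nat_gt M
  linarith [(grow k).2, hM (n + k)]

theorem mem_altFilledJulia_iff_norm_le {c₁ c₂ z : ℂ} :
    z ∈ altFilledJulia c₁ c₂ ↔ ∀ n, ‖altOrbit c₁ c₂ z n‖ ≤ escapeRadius c₁ c₂ :=
  ⟨norm_altOrbit_le_escapeRadius, fun h => ⟨_, (norm_nonneg _).trans (h 0), h⟩⟩

theorem isClosed_altFilledJulia (c₁ c₂ : ℂ) : IsClosed (altFilledJulia c₁ c₂) := by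
  have : altFilledJulia c₁ c₂ =
      ⋂ n, {z | ‖altOrbit c₁ c₂ z n‖ ≤ escapeRadius c₁ c₂} := by
    ext z
    simp [mem_altFilledJulia_iff_norm_le]
  rw [this]
  exact isClosed_iInter fun n =>
    isClosed_le (differentiable_altOrbit c₁ c₂ n).continuous.norm continuous_const

theorem isCompact_altFilledJulia (c₁ c₂ : ℂ) : IsCompact (altFilledJulia c₁ c₂) :=
  (isCompact_closedBall (0 : ℂ) (escapeRadius c₁ c₂)).of_isClosed_subset
    (isClosed_altFilledJulia c₁ c₂) fun z hz => by
      simpa [altOrbit] using norm_altOrbit_le_escapeRadius hz 0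

/-- A bounded set whose frontier lies in the filled Julia set is itself contained in it. -/
theorem subset_altFilledJulia_of_frontier_subset {c₁ c₂ : ℂ} {W : Set ℂ}
    (hb : Bornology.IsBounded W) (hW : frontier W ⊆ altFilledJulia c₁ c₂) :
    W ⊆ altFilledJulia c₁ c₂ := fun _ hz =>
  mem_altFilledJulia_iff_norm_le.2 fun n =>
    Complex.norm_le_of_forall_mem_frontier_norm_le hb
      (differentiable_altOrbit c₁ c₂ n).diffContOnCl
      (fun _ hx => norm_altOrbit_le_escapeRadius (hW hx) n) (subset_closure hz)

/-- The function `z ↦ z - p` has a continuous square root on `L`. -/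
def HasSqrtSubOn (L : Set ℂ) (p : ℂ) : Prop :=
  ∃ s : ℂ → ℂ, ContinuousOn s L ∧ ∀ z ∈ L, s z ^ 2 = z - p

theorem exists_continuousOn_sqrt_one_add {L : Set ℂ} {f : ℂ → ℂ} (hf : ContinuousOn f L)
    (h : ∀ z ∈ L, ‖f z‖ < 1) :
    ∃ s : ℂ → ℂ, ContinuousOn s L ∧ ∀ z ∈ L, s z ^ 2 = 1 + f z :=
  ⟨fun z => (1 + f z) ^ (2⁻¹ : ℂ),
    (continuousOn_const.add hf).cpow_const fun z hz =>
      Complex.mem_slitPlane_of_norm_lt_one (h z hz),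
    fun z _ => by exact_mod_cast Complex.cpow_nat_inv_pow (1 + f z) two_ne_zero⟩

theorem HasSqrtSubOn.of_dist_lt {L : Set ℂ} {p q : ℂ} (hp : HasSqrtSubOn L p)
    (h : ∀ z ∈ L, ‖p - q‖ < ‖z - p‖) : HasSqrtSubOn L q := by
  obtain ⟨s, hs, hs2⟩ := hp
  have h0 : ∀ z ∈ L, z - p ≠ 0 := fun z hz =>
    norm_pos_iff.1 ((norm_nonneg _).trans_lt (h z hz))
  obtain ⟨t, ht, ht2⟩ := exists_continuousOn_sqrt_one_add
    (L := L) (f := fun z => (p - q) / (z - p))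
    (continuousOn_const.div (continuousOn_id.sub continuousOn_const) h0)
    (fun z hz => by
      rw [norm_div, div_lt_one (norm_pos_iff.2 (h0 z hz))]
      exact h z hz)
  refine ⟨fun z => s z * t z, hs.mul ht, fun z hz => ?_⟩
  have := h0 z hz
  rw [mul_pow, hs2 z hz, ht2 z hz]
  field_simp
  ring

theorem HasSqrtSubOn.of_norm_lt {L : Set ℂ} {p : ℂ} (hp : p ≠ 0) (h : ∀ z ∈ L, ‖z‖ < ‖p‖) :
    HasSqrtSubOn L p := by
  obtain ⟨t, ht, ht2⟩ := exists_continuousOn_sqrt_one_add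
    (L := L) (f := fun z => -z / p) (by fun_prop)
    (fun z hz => by
      rw [norm_div, norm_neg, div_lt_one (norm_pos_iff.2 hp)]
      exact h z hz)
  obtain ⟨a, ha⟩ := IsAlgClosed.exists_pow_nat_eq (-p) two_pos
  refine ⟨fun z => a * t z, continuousOn_const.mul ht, fun z hz => ?_⟩
  rw [mul_pow, ha, ht2 z hz]
  field_simp
  ring

theorem IsClosed.exists_ball_hasSqrtSubOn_iff {L : Set ℂ} (hL : IsClosed L) {p : ℂ} (hp : p ∉ L) :
    ∃ ε > 0, ∀ q ∈ Metric.ball p ε, q ∉ L ∧ (HasSqrtSubOn L p ↔ HasSqrtSubOn L q) := by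
  obtain ⟨ε, hε, hball⟩ := Metric.isOpen_iff.1 hL.isOpen_compl p hp
  have far : ∀ z ∈ L, ε ≤ ‖z - p‖ := fun z hz => by
    by_contra! hlt
    exact hball (mem_ball_iff_norm.2 hlt) hz
  refine ⟨ε / 2, half_pos hε, fun q hq => ⟨hball (Metric.ball_subset_ball (by linarith) hq), ?_⟩⟩
  rw [mem_ball_iff_norm] at hq
  refine ⟨fun h => h.of_dist_lt fun z hz => ?_, fun h => h.of_dist_lt fun z hz => ?_⟩
  · rw [norm_sub_rev]
    linarith [far z hz]
  · linarith [far z hz, norm_sub_le_norm_sub_add_norm_sub z q p]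

theorem hasSqrtSubOn_altFilledJulia {c₁ c₂ p : ℂ} (hp : p ∉ altFilledJulia c₁ c₂) :
    HasSqrtSubOn (altFilledJulia c₁ c₂) p := by
  by_contra hsqrt
  set L := altFilledJulia c₁ c₂ with hL
  have hclosed : IsClosed L := isClosed_altFilledJulia c₁ c₂
  let W : Set ℂ := {q | q ∉ L ∧ ¬ HasSqrtSubOn L q}
  have hopen : IsOpen W := Metric.isOpen_iff.2 fun q hq => by
    obtain ⟨ε, hε, h⟩ := hclosed.exists_ball_hasSqrtSubOn_iff hq.1
    exact ⟨ε, hε, fun x hx => ⟨(h x hx).1, fun hx' => hq.2 ((h x hx).2.2 hx')⟩⟩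
  have hfrontier : frontier W ⊆ L := by
    intro q hq
    by_contra hqL
    obtain ⟨ε, hε, h⟩ := hclosed.exists_ball_hasSqrtSubOn_iff hqL
    obtain ⟨x, hxW, hx⟩ := Metric.mem_closure_iff.1 hq.1 ε hε
    rw [hopen.frontier_eq] at hq
    exact hq.2 ⟨hqL, fun hq' => hxW.2 ((h x (by rwa [Metric.mem_ball, dist_comm])).2.1 hq')⟩
  have hbounded : Bornology.IsBounded W := by
    refine Metric.isBounded_closedBall.subset
      (t := Metric.closedBall (0 : ℂ) (escapeRadius c₁ c₂)) fun q hq => ?_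
    rw [mem_closedBall_zero_iff]
    by_contra! hlt
    have hlt' : ∀ z ∈ L, ‖z‖ < ‖q‖ := fun z hz =>
      (norm_altOrbit_le_escapeRadius hz 0).trans_lt hlt
    refine hq.2 (HasSqrtSubOn.of_norm_lt ?_ hlt')
    rintro rfl
    have : 0 ≤ escapeRadius c₁ c₂ := by
      unfold escapeRadius
      positivity
    rw [norm_zero] at hlt
    linarith
  exact hp (subset_altFilledJulia_of_frontier_subset hbounded hfrontier ⟨hp, hsqrt⟩)

/-- If `z - c` has a continuous square root on a nonempty compact set `L` avoiding `c`, then the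
preimage of `L` under `z ↦ z ^ 2 + c` is disconnected. -/
theorem HasSqrtSubOn.not_isPreconnected_preimage {L : Set ℂ} {c : ℂ} (h : HasSqrtSubOn L c)
    (hL : IsCompact L) (hne : L.Nonempty) (hc : c ∉ L) :
    ¬ IsPreconnected {z : ℂ | z ^ 2 + c ∈ L} := by
  intro hconn
  obtain ⟨s, hs, hs2⟩ := h
  have hA : IsClosed (s '' L) := (hL.image_of_continuousOn hs).isClosed
  have hB : IsClosed ((fun z => -s z) '' L) := (hL.image_of_continuousOn hs.neg).isClosed
  have hcover : {z : ℂ | z ^ 2 + c ∈ L} ⊆ s '' L ∪ (fun z => -s z) '' L := by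
    intro z hz
    have hsq : s (z ^ 2 + c) ^ 2 = z ^ 2 := by rw [hs2 _ hz]; ring
    rcases sq_eq_sq_iff_eq_or_eq_neg.1 hsq with e | e
    · exact Or.inl ⟨_, hz, e⟩
    · exact Or.inr ⟨_, hz, by simp [e]⟩
  obtain ⟨x, hx⟩ := hne
  have hx' : s x ^ 2 + c = x := by rw [hs2 x hx]; ring
  obtain ⟨z, -, ⟨a, ha, rfl⟩, b, hb, hab⟩ := isPreconnected_closed_iff.1 hconn _ _ hA hB hcover
    ⟨s x, by simpa [hx'] using hx, x, hx, rfl⟩ ⟨-s x, by simpa [hx'] using hx, x, hx, rfl⟩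
  have hab' : -s b = s a := hab
  have hEq : a = b := by
    have : s a ^ 2 = s b ^ 2 := by rw [← hab', neg_sq]
    rw [hs2 a ha, hs2 b hb] at this
    exact sub_left_injective this
  subst hEq
  have h0 : s a = 0 := self_eq_neg.1 hab'.symm
  have := hs2 a ha
  rw [h0, zero_pow two_ne_zero] at this
  exact hc (sub_eq_zero.1 this.symm ▸ ha)

theorem not_isPreconnected_altFilledJulia {c₁ c₂ : ℂ} (hne : (altFilledJulia c₂ c₁).Nonempty)
    (hc : c₁ ∉ altFilledJulia c₂ c₁) : ¬ IsPreconnected (altFilledJulia c₁ c₂) := by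
  have : altFilledJulia c₁ c₂ = {z | z ^ 2 + c₁ ∈ altFilledJulia c₂ c₁} :=
    Set.ext fun z => mem_altFilledJulia_iff_sq_add_mem c₁ c₂ z
  rw [this]
  exact (hasSqrtSubOn_altFilledJulia hc).not_isPreconnected_preimage
    (isCompact_altFilledJulia c₂ c₁) hne hc

theorem image_sq_add_altFilledJulia (c₁ c₂ : ℂ) :
    (fun z => z ^ 2 + c₁) '' altFilledJulia c₁ c₂ = altFilledJulia c₂ c₁ := by
  ext y
  constructor
  · rintro ⟨z, hz, rfl⟩
    exact (mem_altFilledJulia_iff_sq_add_mem c₁ c₂ z).1 hz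
  · intro hy
    obtain ⟨z, hz⟩ := IsAlgClosed.exists_pow_nat_eq (y - c₁) two_pos
    have hzy : z ^ 2 + c₁ = y := by rw [hz]; ring
    exact ⟨z, (mem_altFilledJulia_iff_sq_add_mem c₁ c₂ z).2 (hzy ▸ hy), hzy⟩

/-- In a preconnected space, a closed set with connected frontier is preconnected. -/
theorem IsClosed.isPreconnected_of_isConnected_frontier {X : Type*} [TopologicalSpace X]
    [PreconnectedSpace X] {K : Set X} (hK : IsClosed K) (h : IsConnected (frontier K)) :
    IsPreconnected K := by
  have key : ∀ A B : Set X, IsClosed A → IsClosed B → K ⊆ A ∪ B → K ∩ (A ∩ B) = ∅ →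
      frontier K ⊆ A → K ⊆ A := by
    intro A B hA hB hcover hdisj hfr
    have hclopen : IsClopen (K ∩ B) := by
      refine ⟨hK.inter hB, ?_⟩
      have : K ∩ B = interior K ∩ Aᶜ := by
        ext x
        constructor
        · rintro ⟨hxK, hxB⟩
          have hxA : x ∉ A := fun hxA => (hdisj ▸ ⟨hxK, hxA, hxB⟩ : x ∈ (∅ : Set X))
          refine ⟨?_, hxA⟩
          by_contra hx
          exact hxA (hfr ⟨subset_closure hxK, hx⟩)
        · rintro ⟨hx, hxA⟩
          exact ⟨interior_subset hx, (hcover (interior_subset hx)).resolve_left hxA⟩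
      rw [this]
      exact isOpen_interior.inter hA.isOpen_compl
    rcases isClopen_iff.1 hclopen with he | hu
    · intro x hx
      refine (hcover hx).resolve_right fun hxB => ?_
      exact (he ▸ ⟨hx, hxB⟩ : x ∈ (∅ : Set X))
    · obtain ⟨x, hx⟩ := h.nonempty
      have hKu : K = Set.univ := Set.eq_univ_of_univ_subset (hu ▸ Set.inter_subset_left)
      simp [hKu] at hx
  rw [isPreconnected_iff_subset_of_disjoint_closed]
  intro A B hA hB hcover hdisj
  have hfr : frontier K ⊆ K := hK.frontier_subset
  rcases isPreconnected_iff_subset_of_disjoint_closed.1 h.isPreconnected A B hA hB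
    (hfr.trans hcover) (Set.subset_eq_empty (Set.inter_subset_inter_left _ hfr) hdisj) with hl | hr
  · exact Or.inl (key A B hA hB hcover hdisj hl)
  · exact Or.inr (key B A hB hA (Set.union_comm A B ▸ hcover) (Set.inter_comm A B ▸ hdisj) hr)

/-- Let `F(z) = (z² + c₁)² + c₂`. If the forward orbit of `0` under `F`
is unbounded, or the forward orbit of some square root of `-c₁` under `F` is unbounded,
then the alternated Julia set (the frontier of the alternated filled Julia set
`K_{c₁c₂}`) is not connected. -/
theorem alternated_julia_not_connected_of_some_critical_orbit_unbounded (c₁ c₂ : ℂ)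
    (h : (¬ ∃ M : ℝ, 0 ≤ M ∧
        ∀ n : ℕ, ‖(fun z : ℂ => (z ^ 2 + c₁) ^ 2 + c₂)^[n] 0‖ ≤ M) ∨
      (∃ w : ℂ, w ^ 2 = -c₁ ∧
        ¬ ∃ M : ℝ, 0 ≤ M ∧
          ∀ n : ℕ, ‖(fun z : ℂ => (z ^ 2 + c₁) ^ 2 + c₂)^[n] w‖ ≤ M)) :
    ¬ IsConnected (frontier {z₀ : ℂ |
      ∃ M : ℝ, 0 ≤ M ∧ ∀ n : ℕ, ‖altOrbit c₁ c₂ z₀ n‖ ≤ M}) := by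
  intro hJ
  change IsConnected (frontier (altFilledJulia c₁ c₂)) at hJ
  have hK₁ : IsPreconnected (altFilledJulia c₁ c₂) :=
    (isClosed_altFilledJulia c₁ c₂).isPreconnected_of_isConnected_frontier hJ
  have hne₁ : (altFilledJulia c₁ c₂).Nonempty :=
    hJ.nonempty.mono (isClosed_altFilledJulia c₁ c₂).frontier_subset
  have hK₂ : IsPreconnected (altFilledJulia c₂ c₁) :=
    image_sq_add_altFilledJulia c₁ c₂ ▸ hK₁.image _ (by fun_prop)
  have hne₂ : (altFilledJulia c₂ c₁).Nonempty :=
    image_sq_add_altFilledJulia c₁ c₂ ▸ hne₁.image _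
  have escape : ∀ z : ℂ, (¬ ∃ M : ℝ, 0 ≤ M ∧
      ∀ n : ℕ, ‖(fun z : ℂ => (z ^ 2 + c₁) ^ 2 + c₂)^[n] z‖ ≤ M) →
      z ^ 2 + c₁ ∉ altFilledJulia c₂ c₁ := fun z hz hmem => by
    obtain ⟨M, hM, hbd⟩ := (mem_altFilledJulia_iff_sq_add_mem c₁ c₂ z).2 hmem
    exact hz ⟨M, hM, fun n => iterate_eq_altOrbit c₁ c₂ z n ▸ hbd (2 * n)⟩
  rcases h with h | ⟨w, hw, h⟩
  · exact not_isPreconnected_altFilledJulia hne₂ (by simpa using escape 0 h) hK₁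
  · have h0 := escape w h
    rw [hw, neg_add_cancel, mem_altFilledJulia_iff_sq_add_mem] at h0
    exact not_isPreconnected_altFilledJulia hne₁ (by simpa using h0) hK₂
end

section
/- Let p be a prime and c ∈ ℂ_p, and let F(z) = z² + c. The forward orbit (Fⁿ(0))_{n≥0} is bounded with respect to the p-adic norm if and only if ‖c‖_p ≤ 1. In other words, the p-adic Mandelbrot set of the quadratic family is exactly the closed unit disk {c ∈ ℂ_p : ‖c‖_p ≤ 1}. -/
namespace IsUltrametricDist

variable {K : Type*} [NormedField K] [IsUltrametricDist K] {c : K}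

theorem norm_iterate_sq_add_le_one (hc : ‖c‖ ≤ 1) (n : ℕ) :
    ‖(fun z : K => z ^ 2 + c)^[n] 0‖ ≤ 1 := by
  induction n with
  | zero => simp
  | succ n ih =>
    rw [Function.iterate_succ_apply']
    refine (norm_add_le_max _ _).trans (max_le ?_ hc)
    rw [norm_pow]
    exact pow_le_one₀ (norm_nonneg _) ih

theorem norm_iterate_succ_sq_add (hc : 1 < ‖c‖) (n : ℕ) :
    ‖(fun z : K => z ^ 2 + c)^[n + 1] 0‖ = ‖c‖ ^ 2 ^ n := by
  induction n with
  | zero => simp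
  | succ n ih =>
    rw [Function.iterate_succ_apply']
    set z := (fun z : K => z ^ 2 + c)^[n + 1] 0
    have hz : ‖z ^ 2‖ = ‖c‖ ^ 2 ^ (n + 1) := by
      rw [norm_pow, ih, ← pow_mul, ← pow_succ]
    have hlt : ‖c‖ < ‖z ^ 2‖ := by
      rw [hz]
      exact lt_self_pow₀ hc (Nat.one_lt_two_pow n.succ_ne_zero)
    rw [norm_add_eq_max_of_norm_ne_norm hlt.ne', max_eq_left hlt.le, hz]

end IsUltrametricDist

/-- Mathlib (at this version) does not contain a construction of the
field `ℂ_p`, so we characterize it by its defining properties: `Cp` is a complete,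
algebraically closed, nonarchimedean normed field that isometrically contains `ℚ_p`.
For `c ∈ ℂ_p` and `F(z) = z² + c`, the forward orbit of `0` under `F` is bounded iff
`‖c‖_p ≤ 1`; i.e. the `p`-adic Mandelbrot set of the quadratic family is exactly the
closed unit disk. -/
theorem padic_quadratic_mandelbrot_eq_unit_disk (p : ℕ) [Fact p.Prime]
    (Cp : Type*) [NormedField Cp] [IsUltrametricDist Cp] [CompleteSpace Cp]
    [IsAlgClosed Cp] [Algebra ℚ_[p] Cp]
    (hiso : ∀ x : ℚ_[p], ‖algebraMap ℚ_[p] Cp x‖ = ‖x‖)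
    (c : Cp) :
    (∃ M : ℝ, 0 ≤ M ∧ ∀ n : ℕ, ‖(fun z : Cp => z ^ 2 + c)^[n] 0‖ ≤ M) ↔ ‖c‖ ≤ 1 := by
  constructor
  · rintro ⟨M, -, hM⟩
    by_contra! hc
    obtain ⟨n, hn⟩ := pow_unbounded_of_one_lt M hc
    have hle : ‖c‖ ^ n ≤ ‖c‖ ^ 2 ^ n := pow_le_pow_right₀ hc.le Nat.lt_two_pow_self.le
    have hbound := hM (n + 1)
    rw [IsUltrametricDist.norm_iterate_succ_sq_add hc] at hbound
    exact (hn.trans_le hle).not_ge hbound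
  · exact fun hc => ⟨1, zero_le_one, IsUltrametricDist.norm_iterate_sq_add_le_one hc⟩
end

section
/- In the field ℚ₂ of 2-adic numbers, let F(z) = z⁴ − (1/2) z² + 9/16. Then for every n ≥ 1, ‖Fⁿ(0)‖₂ = 2^(4ⁿ); in particular the forward orbit of the critical point 0 under F is unbounded, so the 2-adic filled Julia set Q₂(F) is not connected (0 is a critical point of F whose orbit escapes). -/
theorem norm_two_padic : ‖(2 : ℚ_[2])‖ = 2⁻¹ := by
  simpa using Padic.norm_p (p := 2)

theorem norm_nine_padic : ‖(9 : ℚ_[2])‖ = 1 := by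
  have h := (Padic.norm_natCast_eq_one_iff (p := 2) (n := 9)).2 (by norm_num)
  exact_mod_cast h

theorem norm_nine_div_sixteen_padic : ‖(9 / 16 : ℚ_[2])‖ = 16 := by
  rw [show (16 : ℚ_[2]) = 2 ^ 4 by norm_num, norm_div, norm_pow, norm_two_padic, norm_nine_padic]
  norm_num

/-- Outside the disc of radius `2`, the quartic is dominated by its leading term. -/
theorem norm_quartic_eq_pow {z : ℚ_[2]} (hz : 2 < ‖z‖) :
    ‖z ^ 4 - (1 / 2) * z ^ 2 + 9 / 16‖ = ‖z‖ ^ 4 := by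
  have hquad : ‖(1 / 2) * z ^ 2‖ = 2 * ‖z‖ ^ 2 := by
    rw [norm_mul, norm_div, norm_one, norm_pow, norm_two_padic]
    norm_num
  have hsq : 4 < ‖z‖ ^ 2 := by nlinarith
  have hlt : ‖-((1 / 2) * z ^ 2)‖ < ‖z ^ 4‖ := by
    rw [norm_neg, hquad, norm_pow]
    nlinarith
  have hsub : ‖z ^ 4 - (1 / 2) * z ^ 2‖ = ‖z‖ ^ 4 := by
    rw [sub_eq_add_neg, Padic.add_eq_max_of_ne hlt.ne', max_eq_left hlt.le, norm_pow]
  have hconst : ‖(9 / 16 : ℚ_[2])‖ < ‖z ^ 4 - (1 / 2) * z ^ 2‖ := by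
    rw [hsub, norm_nine_div_sixteen_padic]
    nlinarith
  rw [Padic.add_eq_max_of_ne hconst.ne', max_eq_left hconst.le, hsub]

theorem norm_quartic_iterate_zero (n : ℕ) :
    ‖(fun z : ℚ_[2] => z ^ 4 - (1 / 2) * z ^ 2 + 9 / 16)^[n + 1] 0‖ = 2 ^ (4 ^ (n + 1)) := by
  induction n with
  | zero => simp [norm_nine_div_sixteen_padic, -norm_div]; norm_num
  | succ n ih =>
    rw [Function.iterate_succ_apply', norm_quartic_eq_pow, ih, ← pow_mul, ← pow_succ]
    rw [ih]
    exact lt_self_pow₀ one_lt_two (Nat.one_lt_pow n.succ_ne_zero (by norm_num))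

theorem quartic_orbit_zero_unbounded :
    ¬ ∃ M : ℝ, 0 ≤ M ∧ ∀ n : ℕ,
      ‖(fun z : ℚ_[2] => z ^ 4 - (1 / 2) * z ^ 2 + 9 / 16)^[n] 0‖ ≤ M := by
  rintro ⟨M, -, hM⟩
  obtain ⟨n, hn⟩ := pow_unbounded_of_one_lt M one_lt_two
  have hle : (2 : ℝ) ^ n ≤ 2 ^ (4 ^ (n + 1)) :=
    pow_le_pow_right₀ one_le_two (n.le_succ.trans (Nat.lt_pow_self (by norm_num)).le)
  have h := hM (n + 1)
  rw [norm_quartic_iterate_zero] at h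
  linarith


/-- In `ℚ₂`, let `F(z) = z⁴ - (1/2)z² + 9/16`. Then
`‖Fⁿ(0)‖₂ = 2^(4ⁿ)` for every `n ≥ 1`; in particular the forward orbit of the critical
point `0` (a root of `F'(z) = 4z³ - z`) under `F` is unbounded, so `F` has a critical
point with escaping orbit and hence (in the sense of the paper) the `2`-adic filled
Julia set `Q₂(F)` is not connected. -/
theorem two_adic_quartic_critical_orbit_unbounded :
    (∀ n : ℕ, 1 ≤ n →
      ‖(fun z : ℚ_[2] => z ^ 4 - (1 / 2) * z ^ 2 + 9 / 16)^[n] 0‖ = 2 ^ (4 ^ n)) ∧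
    (¬ ∃ M : ℝ, 0 ≤ M ∧ ∀ n : ℕ,
      ‖(fun z : ℚ_[2] => z ^ 4 - (1 / 2) * z ^ 2 + 9 / 16)^[n] 0‖ ≤ M) ∧
    (∃ z : ℚ_[2], 4 * z ^ 3 - z = 0 ∧
      ¬ ∃ M : ℝ, 0 ≤ M ∧ ∀ n : ℕ,
        ‖(fun w : ℚ_[2] => w ^ 4 - (1 / 2) * w ^ 2 + 9 / 16)^[n] z‖ ≤ M) := by
  refine ⟨fun n hn => ?_, quartic_orbit_zero_unbounded, 0, by simp, quartic_orbit_zero_unbounded⟩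
  obtain ⟨m, rfl⟩ := Nat.exists_eq_add_of_le' hn
  exact norm_quartic_iterate_zero m
end
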